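/- Let k ≥ 1 be a constant integer and suppose K_n → ∞, K_n²/P_n → 0, and p_{e,q}(n) = (ln n + (k−1)·ln ln n + b·ln ln n + β_n)/n, where b is a constant integer with k + b ≥ 1 and the real sequence β_n satisfies −1 < liminf_{n→∞} β_n/ln ln n ≤ limsup_{n→∞} β_n/ln ln n < 1. If β_n → −∞, then the probability that the minimum degree δ_n of 𝔾_q(n,K_n,P_n,p_n) equals k+b−1 converges to 1 as n → ∞. -/

import Mathlib

open Finset Filter

/-- A configuration of the random graph `𝔾_q(n,K,P,p)`: a key-ring assignment
(one finite subset of the key pool `Fin P` per vertex) together with the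
on/off states of the channels (one Boolean per unordered pair of vertices). -/
abbrev Config (n P : ℕ) : Type := (Fin n → Finset (Fin P)) × (Sym2 (Fin n) → Bool)

/-- Probability weight of a configuration: the key rings are independent and
uniform over the `K`-element subsets of the pool of size `P`, and the channels
are independent Bernoulli(`p`). -/
noncomputable def weight (n K P : ℕ) (p : ℝ) (ω : Config n P) : ℝ :=
  (∏ i : Fin n, if (ω.1 i).card = K then ((P.choose K : ℝ))⁻¹ else 0) *
  (∏ e : Sym2 (Fin n), if ω.2 e then p else 1 - p)

/-- Probability of an event in `𝔾_q(n,K,P,p)`. -/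
noncomputable def prob (n K P : ℕ) (p : ℝ) (E : Set (Config n P)) : ℝ :=
  ∑ ω : Config n P, Set.indicator E (weight n K P p) ω

/-- Adjacency in `𝔾_q(n,K,P,p)`: two distinct vertices are adjacent iff their
key rings share at least `q` keys and the channel between them is on. -/
def Adj (q n P : ℕ) (ω : Config n P) (i j : Fin n) : Prop :=
  i ≠ j ∧ q ≤ ((ω.1 i) ∩ (ω.1 j)).card ∧ ω.2 s(i, j) = true

/-- Degree of a vertex. -/
noncomputable def degree (q n P : ℕ) (ω : Config n P) (i : Fin n) : ℕ :=
  Nat.card {j : Fin n // Adj q n P ω i j}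

/-- Minimum degree of the graph. -/
noncomputable def minDeg (q n P : ℕ) (ω : Config n P) : ℕ :=
  sInf (Set.range fun i => degree q n P ω i)

/-- `p_{s,q}`: the probability that two key rings share at least `q` keys. -/
noncomputable def psq (q K P : ℕ) : ℝ :=
  1 - ∑ u ∈ Finset.range q,
    ((K.choose u : ℝ) * ((P - K).choose (K - u) : ℝ)) / (P.choose K : ℝ)

/-- `p_{e,q}`: the probability that two distinct vertices are adjacent. -/
noncomputable def peq (q K P : ℕ) (p : ℝ) : ℝ := p * psq q K P

/-! ### Sums over product spaces -/

theorem sum_prod_mul_prod_comp {ι κ V : Type*} [Fintype κ] [DecidableEq κ] [Fintype V]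
    (w : V → ℝ) (hw : ∑ v, w v = 1) (F : Finset ι) (e : ι → κ) (he : Set.InjOn e F)
    (g : ι → V → ℝ) :
    ∑ c : κ → V, (∏ k, w (c k)) * ∏ x ∈ F, g x (c (e x)) = ∏ x ∈ F, ∑ v, w v * g x v := by
  classical
  let G : κ → V → ℝ := fun k v => ∏ x ∈ F with e x = k, g x v
  have hG : ∀ c : κ → V, ∏ x ∈ F, g x (c (e x)) = ∏ k, G k (c k) := by
    intro c
    rw [← Finset.prod_fiberwise F e]
    refine Finset.prod_congr rfl fun k _ => Finset.prod_congr rfl fun x hx => ?_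
    rw [(Finset.mem_filter.1 hx).2]
  have hfib : ∀ x ∈ F, (F.filter fun y => e y = e x) = {x} := by
    intro x hx
    ext y
    simp only [Finset.mem_filter, Finset.mem_singleton]
    constructor
    · rintro ⟨hy, hxy⟩
      exact he hy hx hxy
    · rintro rfl
      exact ⟨hx, rfl⟩
  calc ∑ c : κ → V, (∏ k, w (c k)) * ∏ x ∈ F, g x (c (e x))
      = ∑ c : κ → V, ∏ k, (w (c k) * G k (c k)) := by
        simp_rw [hG, Finset.prod_mul_distrib]
    _ = ∏ k, ∑ v, w v * G k v := by
        rw [Finset.prod_univ_sum, Fintype.piFinset_univ]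
    _ = ∏ k ∈ F.image e, ∑ v, w v * G k v := by
        symm
        refine Finset.prod_subset (Finset.subset_univ _) fun k _ hk => ?_
        have hempty : (F.filter fun y => e y = k) = ∅ := by
          refine Finset.filter_eq_empty_iff.2 fun y hy hyk => hk ?_
          exact Finset.mem_image.2 ⟨y, hy, hyk⟩
        simp [G, hempty, hw]
    _ = ∏ x ∈ F, ∑ v, w v * g x v := by
        rw [Finset.prod_image he]
        refine Finset.prod_congr rfl fun x hx => ?_
        simp [G, hfib x hx]

theorem sum_prod_mul_eq_sum_update {κ V : Type*} [Fintype κ] [DecidableEq κ] [Fintype V]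
    (w : V → ℝ) (hw : ∑ v, w v = 1) (i : κ) (G : (κ → V) → ℝ) :
    ∑ c : κ → V, (∏ k, w (c k)) * G c
      = ∑ v, w v * ∑ c : κ → V, (∏ k, w (c k)) * G (Function.update c i v) := by
  classical
  have key : ∀ H : (κ → V) → ℝ, ∑ c : κ → V, (∏ k, w (c k)) * H c
      = ∑ v, ∑ r : {j // j ≠ i} → V, w v * (∏ j, w (r j)) *
          H ((Equiv.funSplitAt i V).symm (v, r)) := by
    intro H
    rw [← Fintype.sum_prod_type', ← (Equiv.funSplitAt i V).symm.sum_comp]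
    refine Finset.sum_congr rfl fun x _ => ?_
    congr 1
    rw [← Finset.mul_prod_erase Finset.univ _ (Finset.mem_univ i)]
    congr 1
    · simp
    · rw [Finset.prod_subtype (p := fun j => j ≠ i) _ (by simp)]
      refine Finset.prod_congr rfl fun j _ => ?_
      simp [j.2]
  rw [key]
  refine Finset.sum_congr rfl fun v _ => ?_
  rw [key]
  have hup : ∀ v' (r : {j // j ≠ i} → V),
      Function.update ((Equiv.funSplitAt i V).symm (v', r)) i v
        = (Equiv.funSplitAt i V).symm (v, r) := by
    intro v' r
    ext j
    by_cases hj : j = i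
    · subst hj; simp
    · simp [hj]
  simp_rw [hup, mul_assoc, ← Finset.mul_sum]
  rw [← Finset.sum_mul, hw, one_mul]

theorem sum_prod_mul_star {κ V : Type*} [Fintype κ] [DecidableEq κ] [Fintype V]
    (w : V → ℝ) (hw : ∑ v, w v = 1) (i : κ) (J : Finset κ) (hi : i ∉ J)
    (h : κ → V → V → ℝ) :
    ∑ c : κ → V, (∏ k, w (c k)) * ∏ j ∈ J, h j (c i) (c j)
      = ∑ s, w s * ∏ j ∈ J, ∑ t, w t * h j s t := by
  rw [sum_prod_mul_eq_sum_update w hw i]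
  refine Finset.sum_congr rfl fun s _ => ?_
  congr 1
  rw [← sum_prod_mul_prod_comp w hw J id (Function.injective_id.injOn)]
  refine Finset.sum_congr rfl fun c _ => ?_
  congr 1
  refine Finset.prod_congr rfl fun j hj => ?_
  have : j ≠ i := fun h => hi (h ▸ hj)
  simp [this]

theorem sum_prod_mul_double_star {κ V : Type*} [Fintype κ] [DecidableEq κ] [Fintype V]
    (w : V → ℝ) (hw : ∑ v, w v = 1) (i i' : κ) (hii' : i ≠ i') (J : Finset κ) (hi : i ∉ J)
    (hi' : i' ∉ J) (h : κ → V → V → V → ℝ) :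
    ∑ c : κ → V, (∏ k, w (c k)) * ∏ j ∈ J, h j (c i) (c i') (c j)
      = ∑ s, w s * ∑ s', w s' * ∏ j ∈ J, ∑ t, w t * h j s s' t := by
  rw [sum_prod_mul_eq_sum_update w hw i]
  refine Finset.sum_congr rfl fun s _ => ?_
  congr 1
  rw [← sum_prod_mul_star w hw i' J hi' fun j s' t => h j s s' t]
  refine Finset.sum_congr rfl fun c _ => ?_
  congr 1
  refine Finset.prod_congr rfl fun j hj => ?_
  have : j ≠ i := fun h => hi (h ▸ hj)
  simp [this, hii'.symm]

/-- The probability of the outcome `B` for an indicator with mean `x`. -/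
noncomputable def outcome (B : Prop) [Decidable B] (x : ℝ) : ℝ := if B then x else 1 - x

theorem prod_outcome_indicator {α : Type*} [DecidableEq α] (N J A : Finset α) (hA : A ⊆ J) :
    ∏ j ∈ J, outcome (j ∈ A) (if j ∈ N then (1 : ℝ) else 0) = if N ∩ J = A then 1 else 0 := by
  have h1 : ∀ j ∈ J, outcome (j ∈ A) (if j ∈ N then (1 : ℝ) else 0)
      = if (j ∈ N ↔ j ∈ A) then 1 else 0 := by
    intro j _
    unfold outcome
    by_cases h : j ∈ A <;> by_cases h' : j ∈ N <;> simp [h, h']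
  rw [Finset.prod_congr rfl h1, Finset.prod_ite_zero]
  simp only [Finset.prod_const_one]
  refine if_congr ?_ rfl rfl
  constructor
  · intro h
    ext j
    rw [Finset.mem_inter]
    constructor
    · rintro ⟨hN, hJ⟩
      exact (h j hJ).1 hN
    · intro hj
      exact ⟨(h j (hA hj)).2 hj, hA hj⟩
  · rintro rfl j hj
    simp [hj]

theorem indicator_card_inter_eq {α : Type*} [DecidableEq α] (N J : Finset α) (d : ℕ) :
    (if (N ∩ J).card = d then (1 : ℝ) else 0)
      = ∑ A ∈ J.powersetCard d, ∏ j ∈ J, outcome (j ∈ A) (if j ∈ N then (1 : ℝ) else 0) := by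
  rw [Finset.sum_congr rfl fun A hA =>
    prod_outcome_indicator N J A (Finset.mem_powersetCard.1 hA).1, Finset.sum_ite_eq]
  simp [Finset.mem_powersetCard]

/-- The number of `d`-subsets of `J` that meet a given set `A ⊆ J` in exactly `i` elements. -/
theorem card_filter_inter_card_eq {α : Type*} [DecidableEq α] (J A : Finset α) (hA : A ⊆ J)
    (d i : ℕ) (hi : i ≤ d) :
    ((J.powersetCard d).filter fun B => (A ∩ B).card = i).card
      = A.card.choose i * (J.card - A.card).choose (d - i) := by
  rw [← Finset.card_sdiff_of_subset hA, ← Finset.card_powersetCard, ← Finset.card_powersetCard,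
    ← Finset.card_product]
  refine Finset.card_bij' (fun B _ => (A ∩ B, B \ A)) (fun X _ => X.1 ∪ X.2) ?_ ?_ ?_ ?_
  · intro B hB
    simp only [Finset.mem_filter, Finset.mem_powersetCard] at hB
    obtain ⟨⟨hBJ, hBd⟩, hBi⟩ := hB
    have h2 := Finset.card_sdiff_add_card_inter B A
    rw [Finset.inter_comm] at h2
    simp only [Finset.mem_product, Finset.mem_powersetCard]
    exact ⟨⟨Finset.inter_subset_left, hBi⟩, Finset.sdiff_subset_sdiff hBJ subset_rfl, by omega⟩
  · rintro ⟨X, Y⟩ h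
    simp only [Finset.mem_product, Finset.mem_powersetCard] at h
    obtain ⟨⟨hXA, hXi⟩, hYJ, hYd⟩ := h
    have hdis : Disjoint A Y := by
      rw [Finset.disjoint_left]
      intro x hx hy
      exact (Finset.mem_sdiff.1 (hYJ hy)).2 hx
    simp only [Finset.mem_filter, Finset.mem_powersetCard]
    refine ⟨⟨Finset.union_subset (hXA.trans hA) (hYJ.trans Finset.sdiff_subset), ?_⟩, ?_⟩
    · rw [Finset.card_union_of_disjoint (hdis.mono_left hXA)]; omega
    · rw [Finset.inter_union_distrib_left, Finset.inter_eq_right.2 hXA,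
        Finset.disjoint_iff_inter_eq_empty.1 hdis, Finset.union_empty, hXi]
  · intro B _
    ext x
    simp only [Finset.mem_union, Finset.mem_inter, Finset.mem_sdiff]
    tauto
  · rintro ⟨X, Y⟩ h
    simp only [Finset.mem_product, Finset.mem_powersetCard] at h
    obtain ⟨⟨hXA, hXi⟩, hYJ, hYd⟩ := h
    have hY : ∀ x ∈ Y, x ∉ A := fun x hx => (Finset.mem_sdiff.1 (hYJ hx)).2
    ext x
    · simp only [Finset.mem_inter, Finset.mem_union]
      constructor
      · rintro ⟨hxA, hx | hx⟩
        · exact hx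
        · exact absurd hxA (hY x hx)
      · exact fun hx => ⟨hXA hx, Or.inl hx⟩
    · simp only [Finset.mem_sdiff, Finset.mem_union]
      constructor
      · rintro ⟨hx | hx, hxA⟩
        · exact absurd (hXA hx) hxA
        · exact hx
      · exact fun hx => ⟨Or.inr hx, hY x hx⟩

/-! ### Key rings -/

/-- Probability weight of a single key ring. -/
noncomputable def ringWeight (K P : ℕ) (s : Finset (Fin P)) : ℝ :=
  if s.card = K then ((P.choose K : ℝ))⁻¹ else 0

/-- Indicator that two key rings share at least `q` keys. -/
noncomputable def share {P : ℕ} (q : ℕ) (s t : Finset (Fin P)) : ℝ :=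
  if q ≤ (s ∩ t).card then 1 else 0

theorem share_nonneg {P : ℕ} (q : ℕ) (s t : Finset (Fin P)) : 0 ≤ share q s t := by
  unfold share; split_ifs <;> norm_num

theorem share_le_one {P : ℕ} (q : ℕ) (s t : Finset (Fin P)) : share q s t ≤ 1 := by
  unfold share; split_ifs <;> norm_num

theorem share_comm {P : ℕ} (q : ℕ) (s t : Finset (Fin P)) : share q s t = share q t s := by
  unfold share; rw [Finset.inter_comm]

theorem ringWeight_nonneg (K P : ℕ) (s : Finset (Fin P)) : 0 ≤ ringWeight K P s := by
  unfold ringWeight; split_ifs <;> positivity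

theorem sum_ringWeight_mul (K P : ℕ) (f : Finset (Fin P) → ℝ) :
    ∑ s, ringWeight K P s * f s
      = (∑ s ∈ (Finset.univ : Finset (Fin P)).powersetCard K, f s) / (P.choose K : ℝ) := by
  simp only [ringWeight, ite_mul, zero_mul]
  rw [← Finset.sum_filter, Finset.sum_div]
  refine Finset.sum_congr (by ext s; simp [Finset.mem_powersetCard]) fun s _ => ?_
  rw [div_eq_inv_mul]

theorem sum_ringWeight (K P : ℕ) (hKP : K ≤ P) : ∑ s, ringWeight K P s = 1 := by
  have h := sum_ringWeight_mul K P fun _ => 1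
  simp only [mul_one, Finset.sum_const, Finset.card_powersetCard, Finset.card_univ,
    Fintype.card_fin, nsmul_eq_mul] at h
  rw [h, div_self]
  exact_mod_cast (Nat.choose_pos hKP).ne'

theorem sum_ringWeight_inter_card_eq (K P u : ℕ) (hu : u ≤ K) (t : Finset (Fin P)) :
    ∑ s, ringWeight K P s * (if (t ∩ s).card = u then 1 else 0)
      = ((t.card.choose u : ℝ) * ((P - t.card).choose (K - u) : ℝ)) / (P.choose K : ℝ) := by
  rw [sum_ringWeight_mul, Finset.sum_boole,
    card_filter_inter_card_eq _ _ (Finset.subset_univ t) _ _ hu]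
  simp

theorem share_eq_one_sub {P : ℕ} (q : ℕ) (s t : Finset (Fin P)) :
    share q t s = 1 - ∑ u ∈ Finset.range q, if (t ∩ s).card = u then (1 : ℝ) else 0 := by
  rw [Finset.sum_ite_eq, share]
  by_cases h : q ≤ (t ∩ s).card
  · simp [h, not_lt.2 h]
  · simp [h, not_le.1 h]

theorem sum_ringWeight_share (q K P : ℕ) (hKP : K ≤ P) (hqK : q ≤ K) (t : Finset (Fin P))
    (ht : t.card = K) : ∑ s, ringWeight K P s * share q t s = psq q K P := by
  simp_rw [share_eq_one_sub, mul_sub, Finset.sum_sub_distrib, Finset.mul_sum]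
  rw [Finset.sum_comm, psq]
  simp_rw [mul_one]
  rw [sum_ringWeight K P hKP]
  congr 1
  refine Finset.sum_congr rfl fun u hu => ?_
  rw [sum_ringWeight_inter_card_eq K P u (by have := Finset.mem_range.1 hu; omega), ht]

theorem choose_sub_mul_pow_le (K P t : ℕ) (hKP : K ≤ P) (ht : t ≤ K) :
    (P - t).choose (K - t) * P ^ t ≤ P.choose K * K ^ t := by
  induction t with
  | zero => simp
  | succ t ih =>
    have ih' := ih (by omega)
    obtain ⟨a, rfl⟩ : ∃ a, K = a + (t + 1) := ⟨K - (t + 1), by omega⟩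
    obtain ⟨b, rfl⟩ : ∃ b, P = b + (t + 1) := ⟨P - (t + 1), by omega⟩
    have e1 : b + (t + 1) - (t + 1) = b := by omega
    have e2 : a + (t + 1) - (t + 1) = a := by omega
    have e3 : b + (t + 1) - t = b + 1 := by omega
    have e4 : a + (t + 1) - t = a + 1 := by omega
    rw [e3, e4] at ih'
    rw [e1, e2]
    have hab : a ≤ b := by omega
    have hstep := Nat.add_one_mul_choose_eq b a
    have h1 : b.choose a * (b + (t + 1)) ≤ (b + 1).choose (a + 1) * (a + (t + 1)) := by
      refine Nat.le_of_mul_le_mul_left ?_ (show 0 < b + 1 by omega)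
      calc (b + 1) * (b.choose a * (b + (t + 1)))
          = (b + 1).choose (a + 1) * ((a + 1) * (b + (t + 1))) := by
            rw [← mul_assoc, hstep]; ring
        _ ≤ (b + 1).choose (a + 1) * ((b + 1) * (a + (t + 1))) := by
            refine Nat.mul_le_mul_left _ ?_
            nlinarith
        _ = _ := by ring
    calc b.choose a * (b + (t + 1)) ^ (t + 1)
        = (b.choose a * (b + (t + 1))) * (b + (t + 1)) ^ t := by ring
      _ ≤ ((b + 1).choose (a + 1) * (a + (t + 1))) * (b + (t + 1)) ^ t :=
          Nat.mul_le_mul_right _ h1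
      _ = ((b + 1).choose (a + 1) * (b + (t + 1)) ^ t) * (a + (t + 1)) := by ring
      _ ≤ _ := Nat.mul_le_mul_right _ ih'
      _ = _ := by ring

theorem sum_ringWeight_subset_le (K P : ℕ) (hKP : K ≤ P) (A : Finset (Fin P)) :
    ∑ s, ringWeight K P s * (if A ⊆ s then 1 else 0) ≤ ((K : ℝ) / P) ^ A.card := by
  by_cases hA : A.card ≤ K
  · have h : ∀ s : Finset (Fin P), (if A ⊆ s then (1 : ℝ) else 0)
        = if (A ∩ s).card = A.card then 1 else 0 := by
      intro s
      refine if_congr ?_ rfl rfl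
      constructor
      · intro h
        rw [Finset.inter_eq_left.2 h]
      · intro h
        exact Finset.inter_eq_left.1 (Finset.eq_of_subset_of_card_le Finset.inter_subset_left h.ge)
    simp_rw [h]
    rw [sum_ringWeight_inter_card_eq K P _ hA, Nat.choose_self, Nat.cast_one, one_mul, div_pow]
    have hC : (0 : ℝ) < P.choose K := by exact_mod_cast Nat.choose_pos hKP
    rcases Nat.eq_zero_or_pos P with hP | hP
    · subst hP
      have : A = ∅ := Finset.eq_empty_of_isEmpty A
      have hK : K = 0 := by omega
      subst this hK
      simp
    · rw [div_le_div_iff₀ hC (by positivity), mul_comm ((K : ℝ) ^ _)]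
      exact_mod_cast choose_sub_mul_pow_le K P A.card hKP hA
  · refine le_trans (le_of_eq ?_) (by positivity : (0 : ℝ) ≤ ((K : ℝ) / P) ^ A.card)
    refine Finset.sum_eq_zero fun s _ => ?_
    unfold ringWeight
    split_ifs with h1 h2 <;> simp
    have := Finset.card_le_card h2
    omega

theorem sum_ringWeight_share_le (K P r : ℕ) (hKP : K ≤ P) (T : Finset (Fin P)) :
    ∑ s, ringWeight K P s * share r T s ≤ (T.card * (K / P) : ℝ) ^ r := by
  have h1 : ∀ s, share r T s ≤ ∑ A ∈ T.powersetCard r, if A ⊆ s then (1 : ℝ) else 0 := by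
    intro s
    unfold share
    split_ifs with h
    · obtain ⟨A, hA, hAr⟩ := Finset.exists_subset_card_eq h
      have hmem : A ∈ T.powersetCard r :=
        Finset.mem_powersetCard.2 ⟨hA.trans Finset.inter_subset_left, hAr⟩
      have := Finset.single_le_sum (f := fun A => if A ⊆ s then (1 : ℝ) else 0)
        (fun B _ => by split_ifs <;> norm_num) hmem
      simpa [hA.trans Finset.inter_subset_right] using this
    · exact Finset.sum_nonneg fun B _ => by split_ifs <;> norm_num
  calc ∑ s, ringWeight K P s * share r T s
      ≤ ∑ s, ringWeight K P s * ∑ A ∈ T.powersetCard r, (if A ⊆ s then (1 : ℝ) else 0) :=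
        Finset.sum_le_sum fun s _ => mul_le_mul_of_nonneg_left (h1 s) (ringWeight_nonneg K P s)
    _ = ∑ A ∈ T.powersetCard r, ∑ s, ringWeight K P s * (if A ⊆ s then (1 : ℝ) else 0) := by
        simp_rw [Finset.mul_sum]
        rw [Finset.sum_comm]
    _ ≤ ∑ A ∈ T.powersetCard r, ((K : ℝ) / P) ^ r := by
        refine Finset.sum_le_sum fun A hA => ?_
        rw [← (Finset.mem_powersetCard.1 hA).2]
        exact sum_ringWeight_subset_le K P hKP A
    _ = (T.card.choose r : ℝ) * ((K : ℝ) / P) ^ r := by simp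
    _ ≤ (T.card : ℝ) ^ r * ((K : ℝ) / P) ^ r := by
        gcongr
        exact_mod_cast Nat.choose_le_pow _ _
    _ = _ := by rw [mul_pow]

/-- The probability that a random key ring shares at least `q` keys with both `s₁` and `s₂`. -/
noncomputable def overlap (q K P : ℕ) (s₁ s₂ : Finset (Fin P)) : ℝ :=
  ∑ t, ringWeight K P t * (share q s₁ t * share q s₂ t)

theorem share_mul_share_le {P : ℕ} (q : ℕ) (s₁ s₂ t : Finset (Fin P)) :
    share q s₁ t * share q s₂ t ≤ share (q + 1) (s₁ ∪ s₂) t + share q (s₁ ∩ s₂) t := by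
  by_cases h : q ≤ (s₁ ∩ t).card ∧ q ≤ (s₂ ∩ t).card
  · have hu : ((s₁ ∪ s₂) ∩ t).card + ((s₁ ∩ s₂) ∩ t).card = (s₁ ∩ t).card + (s₂ ∩ t).card := by
      rw [← Finset.card_union_add_card_inter (s₁ ∩ t) (s₂ ∩ t), Finset.union_inter_distrib_right,
        Finset.inter_inter_distrib_right]
    have : q + 1 ≤ ((s₁ ∪ s₂) ∩ t).card ∨ q ≤ ((s₁ ∩ s₂) ∩ t).card := by omega
    have h1 := share_nonneg (q + 1) (s₁ ∪ s₂) t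
    have h2 := share_nonneg q (s₁ ∩ s₂) t
    have h3 : share q s₁ t * share q s₂ t = 1 := by simp [share, h.1, h.2]
    rcases this with h' | h'
    · have : share (q + 1) (s₁ ∪ s₂) t = 1 := by simp [share, h']
      linarith
    · have : share q (s₁ ∩ s₂) t = 1 := if_pos h'
      linarith
  · have h3 : share q s₁ t * share q s₂ t = 0 := by
      unfold share
      rw [not_and_or] at h
      rcases h with h | h <;> simp [h]
    rw [h3]
    exact add_nonneg (share_nonneg _ _ _) (share_nonneg _ _ _)

theorem overlap_le (q K P : ℕ) (hKP : K ≤ P) (s₁ s₂ : Finset (Fin P)) (h₁ : s₁.card = K)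
    (h₂ : s₂.card = K) :
    overlap q K P s₁ s₂ ≤ (2 * ((K : ℝ) ^ 2 / P)) ^ (q + 1)
      + ((s₁ ∩ s₂).card * (K / P) : ℝ) ^ q := by
  calc overlap q K P s₁ s₂
      ≤ ∑ t, ringWeight K P t * (share (q + 1) (s₁ ∪ s₂) t + share q (s₁ ∩ s₂) t) :=
        Finset.sum_le_sum fun t _ =>
          mul_le_mul_of_nonneg_left (share_mul_share_le q s₁ s₂ t) (ringWeight_nonneg K P t)
    _ = ∑ t, ringWeight K P t * share (q + 1) (s₁ ∪ s₂) t
        + ∑ t, ringWeight K P t * share q (s₁ ∩ s₂) t := by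
        simp_rw [mul_add, Finset.sum_add_distrib]
    _ ≤ ((s₁ ∪ s₂).card * (K / P) : ℝ) ^ (q + 1) + ((s₁ ∩ s₂).card * (K / P) : ℝ) ^ q :=
        add_le_add (sum_ringWeight_share_le K P _ hKP _) (sum_ringWeight_share_le K P _ hKP _)
    _ ≤ _ := by
        have : ((s₁ ∪ s₂).card : ℝ) ≤ 2 * K := by
          have := Finset.card_union_le s₁ s₂
          rw [h₁, h₂] at this
          have h' : ((s₁ ∪ s₂).card : ℝ) ≤ (K : ℝ) + K := by exact_mod_cast this
          linarith
        have h3 : (2 * ((K : ℝ) ^ 2 / P)) = 2 * K * (K / P) := by ring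
        rw [h3]
        gcongr

theorem overlap_nonneg (q K P : ℕ) (s₁ s₂ : Finset (Fin P)) : 0 ≤ overlap q K P s₁ s₂ :=
  Finset.sum_nonneg fun t _ => mul_nonneg (ringWeight_nonneg K P t)
    (mul_nonneg (share_nonneg _ _ _) (share_nonneg _ _ _))

theorem overlap_le_psq (q K P : ℕ) (hKP : K ≤ P) (hqK : q ≤ K) (s₁ s₂ : Finset (Fin P))
    (h₁ : s₁.card = K) : overlap q K P s₁ s₂ ≤ psq q K P := by
  rw [← sum_ringWeight_share q K P hKP hqK s₁ h₁]
  exact Finset.sum_le_sum fun t _ => mul_le_mul_of_nonneg_left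
    (mul_le_of_le_one_right (share_nonneg _ _ _) (share_le_one _ _ _)) (ringWeight_nonneg K P t)

theorem psq_nonneg (q K P : ℕ) (hKP : K ≤ P) (hqK : q ≤ K) : 0 ≤ psq q K P := by
  obtain ⟨t, -, ht⟩ := Finset.exists_subset_card_eq
    (show K ≤ (Finset.univ : Finset (Fin P)).card by simpa using hKP)
  exact (overlap_nonneg q K P t t).trans (overlap_le_psq q K P hKP hqK t t ht)

theorem sum_sum_ringWeight_overlap (q K P : ℕ) (hKP : K ≤ P) (hqK : q ≤ K) :
    ∑ s₁, ringWeight K P s₁ * ∑ s₂, ringWeight K P s₂ * overlap q K P s₁ s₂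
      = psq q K P ^ 2 := by
  have h : ∀ t : Finset (Fin P), ringWeight K P t * (∑ s, ringWeight K P s * share q s t) ^ 2
      = ringWeight K P t * psq q K P ^ 2 := by
    intro t
    by_cases ht : t.card = K
    · simp_rw [share_comm q _ t]
      rw [sum_ringWeight_share q K P hKP hqK t ht]
    · simp [ringWeight, ht]
  calc ∑ s₁, ringWeight K P s₁ * ∑ s₂, ringWeight K P s₂ * overlap q K P s₁ s₂
      = ∑ s₁, ∑ s₂, ∑ t, ringWeight K P t *
          ((ringWeight K P s₁ * share q s₁ t) * (ringWeight K P s₂ * share q s₂ t)) := by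
        simp_rw [overlap, Finset.mul_sum]
        refine Finset.sum_congr rfl fun _ _ => Finset.sum_congr rfl fun _ _ =>
          Finset.sum_congr rfl fun _ _ => by ring
    _ = ∑ t, ringWeight K P t * (∑ s, ringWeight K P s * share q s t) ^ 2 := by
        rw [Finset.sum_congr rfl fun s₁ _ => Finset.sum_comm, Finset.sum_comm]
        refine Finset.sum_congr rfl fun t _ => ?_
        rw [sq, Finset.sum_mul_sum, Finset.mul_sum]
        simp_rw [Finset.mul_sum]
    _ = _ := by
        rw [Finset.sum_congr rfl fun t _ => h t, ← Finset.sum_mul, sum_ringWeight K P hKP, one_mul]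

/-- The constant in the lower bound for `psq`. -/
noncomputable def psqConst (q : ℕ) : ℝ := 1 / (2 * 4 ^ q * q.factorial)

theorem psqConst_pos (q : ℕ) : 0 < psqConst q := by unfold psqConst; positivity

theorem le_psq (q K P : ℕ) (hKP : K ≤ P) (hq : 2 * q ≤ K) (hK : 1 ≤ K)
    (hx : (K : ℝ) ^ 2 / P ≤ 1 / 4) :
    psqConst q * ((K : ℝ) ^ 2 / P) ^ q ≤ psq q K P := by
  have hP : (0 : ℝ) < P := by exact_mod_cast hK.trans hKP
  have hK0 : (0 : ℝ) < K := by exact_mod_cast hK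
  have hKsq : 4 * (K : ℝ) ^ 2 ≤ P := by
    rw [div_le_iff₀ hP] at hx; linarith
  have hKP4 : 4 * K ≤ P := by
    have : (4 * K : ℝ) ≤ P := by
      have : (1 : ℝ) ≤ K := by exact_mod_cast hK
      nlinarith
    exact_mod_cast this
  have hC : (0 : ℝ) < P.choose K := by exact_mod_cast Nat.choose_pos hKP
  obtain ⟨t, -, ht⟩ := Finset.exists_subset_card_eq
    (show K ≤ (Finset.univ : Finset (Fin P)).card by simpa using hKP)
  have h1 : ((K.choose q : ℝ) * ((P - K).choose (K - q) : ℝ)) / (P.choose K : ℝ) ≤ psq q K P := by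
    rw [← sum_ringWeight_share q K P hKP (by omega) t ht, ← ht]
    rw [← sum_ringWeight_inter_card_eq _ P q (by omega) t]
    refine Finset.sum_le_sum fun s _ => mul_le_mul_of_nonneg_left ?_ (ringWeight_nonneg _ P s)
    unfold share
    split_ifs with ha hb
    · exact le_rfl
    · omega
    · exact zero_le_one
    · exact le_rfl
  refine le_trans ?_ h1
  have hhalf : ∀ j : ℕ, j ≤ q → (K : ℝ) / 2 ≤ (K : ℝ) - j := by
    intro j hj
    have : (2 * q : ℝ) ≤ K := by exact_mod_cast hq
    have : (j : ℝ) ≤ q := by exact_mod_cast hj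
    linarith
  have hbase : (K : ℝ) / 2 ≤ ((K + 1 - q : ℕ) : ℝ) := by
    rw [Nat.cast_sub (by omega)]
    have := hhalf q le_rfl
    push_cast
    linarith
  have h2 : ((K : ℝ) / 2) ^ q / q.factorial ≤ (K.choose q : ℝ) := by
    refine le_trans ?_ (Nat.pow_le_choose q K)
    gcongr
  have h3 : ((P : ℝ) - 2 * K) ^ (K - q) / (K - q).factorial ≤ ((P - K).choose (K - q) : ℝ) := by
    refine le_trans ?_ (Nat.pow_le_choose (K - q) (P - K))
    have hnn : (0 : ℝ) ≤ (P : ℝ) - 2 * K := by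
      have : (4 * K : ℝ) ≤ P := by exact_mod_cast hKP4
      linarith
    have : (P : ℝ) - 2 * K ≤ ((P - K + 1 - (K - q) : ℕ) : ℝ) := by
      have h5 : P ≤ (P - K + 1 - (K - q)) + 2 * K := by omega
      have : (P : ℝ) ≤ ((P - K + 1 - (K - q) : ℕ) : ℝ) + 2 * K := by exact_mod_cast h5
      linarith
    gcongr
  have h4 : (P.choose K : ℝ) ≤ (P : ℝ) ^ K / K.factorial := Nat.choose_le_pow_div K P
  have hbern : (1 / 2 : ℝ) * (P : ℝ) ^ (K - q) ≤ ((P : ℝ) - 2 * K) ^ (K - q) := by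
    have hb := one_add_mul_le_pow (a := -(2 * K / P : ℝ)) (by
      have : (2 * K / P : ℝ) ≤ 1 := by
        rw [div_le_one hP]
        have : (4 * K : ℝ) ≤ P := by exact_mod_cast hKP4
        linarith
      linarith) (K - q)
    have h6 : ((K - q : ℕ) : ℝ) * (2 * K / P) ≤ 1 / 2 := by
      have : ((K - q : ℕ) : ℝ) ≤ K := by exact_mod_cast Nat.sub_le K q
      calc ((K - q : ℕ) : ℝ) * (2 * K / P) ≤ K * (2 * K / P) := by gcongr
        _ = 2 * ((K : ℝ) ^ 2 / P) := by ring
        _ ≤ 1 / 2 := by linarith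
    have h7 : ((P : ℝ) - 2 * K) = (1 + -(2 * K / P)) * P := by field_simp; ring
    rw [h7, mul_pow]
    gcongr
    linarith
  have hfac : ((K : ℝ) / 2) ^ q * (K - q).factorial ≤ (K.factorial : ℝ) := by
    have hd := Nat.pow_sub_le_descFactorial K q
    have he := Nat.factorial_mul_descFactorial (show q ≤ K by omega)
    calc ((K : ℝ) / 2) ^ q * (K - q).factorial
        ≤ ((K + 1 - q : ℕ) : ℝ) ^ q * (K - q).factorial := by gcongr
      _ ≤ (K.descFactorial q : ℝ) * (K - q).factorial := by gcongr; exact_mod_cast hd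
      _ = K.factorial := by rw [← he]; push_cast; ring
  have hPK : (P : ℝ) ^ K = (P : ℝ) ^ q * (P : ℝ) ^ (K - q) := by
    rw [← pow_add]; congr 1; omega
  calc psqConst q * ((K : ℝ) ^ 2 / P) ^ q
      = (((K : ℝ) / 2) ^ q / q.factorial * (1 / 2 * (P : ℝ) ^ (K - q) / (K - q).factorial))
          * (((K : ℝ) / 2) ^ q * (K - q).factorial) / P ^ K := by
        rw [hPK, psqConst, div_pow, div_pow, ← pow_mul, mul_comm 2 q, pow_mul,
          show (4 : ℝ) = 2 * 2 by norm_num, mul_pow]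
        field_simp
    _ ≤ ((K.choose q : ℝ) * ((P - K).choose (K - q) : ℝ)) * K.factorial / P ^ K := by
        gcongr
        refine le_trans ?_ h3
        gcongr
    _ ≤ ((K.choose q : ℝ) * ((P - K).choose (K - q) : ℝ)) / (P.choose K : ℝ) := by
        rw [div_le_div_iff₀ (by positivity) hC]
        rw [le_div_iff₀ (by positivity)] at h4
        calc _ = ((K.choose q : ℝ) * ((P - K).choose (K - q) : ℝ)) *
              (P.choose K * K.factorial) := by ring
          _ ≤ _ := by gcongr

/-! ### Degree laws -/

/-- Expectation in `𝔾_q(n,K,P,p)`. -/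
noncomputable def mean (n K P : ℕ) (p : ℝ) (f : Config n P → ℝ) : ℝ :=
  ∑ ω, weight n K P p ω * f ω

/-- Neighbours of a vertex. -/
def nbrs (q : ℕ) {n P : ℕ} (ω : Config n P) (i : Fin n) : Finset (Fin n) :=
  Finset.univ.filter fun j => i ≠ j ∧ q ≤ (ω.1 i ∩ ω.1 j).card ∧ ω.2 s(i, j) = true

theorem degree_eq_card_nbrs (q n P : ℕ) (ω : Config n P) (i : Fin n) :
    degree q n P ω i = (nbrs q ω i).card := by
  rw [degree, Nat.subtype_card (nbrs q ω i)]
  intro j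
  simp [nbrs, Adj]

theorem sum_channel (p : ℝ) : ∑ v : Bool, (if v then p else 1 - p) = 1 := by simp

theorem mean_prod_outcome (q n K P : ℕ) (p : ℝ) (I J : Finset (Fin n)) (hIJ : Disjoint I J)
    (T : Fin n → Finset (Fin n)) :
    mean n K P p (fun ω => ∏ x ∈ I ×ˢ J,
        outcome (x.2 ∈ T x.1) (if x.2 ∈ nbrs q ω x.1 then 1 else 0))
      = ∑ S : Fin n → Finset (Fin P), (∏ k, ringWeight K P (S k)) *
        ∏ x ∈ I ×ˢ J, outcome (x.2 ∈ T x.1) (p * share q (S x.1) (S x.2)) := by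
  have hne : ∀ x ∈ I ×ˢ J, x.1 ≠ x.2 := by
    intro x hx h
    rw [Finset.mem_product] at hx
    exact Finset.disjoint_left.1 hIJ hx.1 (h ▸ hx.2)
  have hinj : Set.InjOn (fun x : Fin n × Fin n => s(x.1, x.2)) (I ×ˢ J : Finset _) := by
    rintro ⟨x, y⟩ hx ⟨x', y'⟩ hx' h
    simp only [Finset.coe_product, Set.mem_prod, Finset.mem_coe] at hx hx'
    rcases Sym2.eq_iff.1 h with ⟨h1, h2⟩ | ⟨h1, h2⟩
    · exact Prod.ext h1 h2
    · dsimp only at h1 h2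
      exact absurd hx'.2 (Finset.disjoint_left.1 hIJ (h1 ▸ hx.1))
  rw [mean, Fintype.sum_prod_type]
  refine Finset.sum_congr rfl fun S _ => ?_
  simp only [weight, mul_assoc]
  refine (Finset.mul_sum (Finset.univ : Finset (Sym2 (Fin n) → Bool))
    (fun c => (∏ e, if c e then p else 1 - p) * ∏ x ∈ I ×ˢ J, outcome (x.2 ∈ T x.1)
      (if x.2 ∈ nbrs q ((S, c) : Config n P) x.1 then (1 : ℝ) else 0))
    (∏ k, ringWeight K P (S k))).symm.trans ?_
  congr 1
  have h := sum_prod_mul_prod_comp (fun v : Bool => if v then p else 1 - p) (sum_channel p)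
    (I ×ˢ J) (fun x => s(x.1, x.2)) hinj
    (fun x v => outcome (x.2 ∈ T x.1) (share q (S x.1) (S x.2) * if v then 1 else 0))
  calc _ = _ := ?_
    _ = _ := h
    _ = _ := ?_
  · refine Finset.sum_congr rfl fun c _ => ?_
    congr 1
    refine Finset.prod_congr rfl fun x hx => ?_
    congr 1
    simp only [nbrs, share, Finset.mem_filter, Finset.mem_univ, true_and]
    by_cases h1 : q ≤ (S x.1 ∩ S x.2).card <;> by_cases h2 : c s(x.1, x.2) = true <;>
      simp [h1, h2, hne x hx]
  · refine Finset.prod_congr rfl fun x _ => ?_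
    rw [Fintype.sum_bool]
    by_cases hB : x.2 ∈ T x.1
    · simp [outcome, hB]
    · simp [outcome, hB]
      ring

theorem sum_ringWeight_outcome (q K P : ℕ) (p : ℝ) (hKP : K ≤ P) (hqK : q ≤ K)
    (B : Prop) [Decidable B] (s : Finset (Fin P)) (hs : s.card = K) :
    ∑ t, ringWeight K P t * outcome B (p * share q s t) = outcome B (peq q K P p) := by
  have h1 : ∑ t, ringWeight K P t * (p * share q s t) = peq q K P p := by
    rw [peq, ← sum_ringWeight_share q K P hKP hqK s hs, Finset.mul_sum]
    exact Finset.sum_congr rfl fun t _ => by ring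
  unfold outcome
  split_ifs
  · exact h1
  · simp_rw [mul_sub, Finset.sum_sub_distrib, h1, mul_one]
    rw [sum_ringWeight K P hKP]

theorem prod_outcome_mem {α : Type*} [DecidableEq α] (J A : Finset α) (hA : A ⊆ J) (x : ℝ) :
    ∏ j ∈ J, outcome (j ∈ A) x = x ^ A.card * (1 - x) ^ (J.card - A.card) := by
  unfold outcome
  rw [Finset.prod_ite, Finset.prod_const, Finset.prod_const, Finset.filter_mem_eq_inter,
    Finset.inter_eq_right.2 hA, Finset.filter_notMem_eq_sdiff, Finset.card_sdiff_of_subset hA]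

/-- The degree of a vertex is binomially distributed. -/
theorem mean_degree_eq (q n K P : ℕ) (p : ℝ) (hKP : K ≤ P) (hqK : q ≤ K) (i : Fin n) (d : ℕ) :
    mean n K P p (fun ω => if (nbrs q ω i).card = d then 1 else 0)
      = (n - 1).choose d * peq q K P p ^ d * (1 - peq q K P p) ^ (n - 1 - d) := by
  have hJ : ({i}ᶜ : Finset (Fin n)).card = n - 1 := by simp [Finset.card_compl]
  have h1 : ∀ ω : Config n P, (if (nbrs q ω i).card = d then (1 : ℝ) else 0)
      = ∑ A ∈ ({i}ᶜ : Finset (Fin n)).powersetCard d, ∏ x ∈ {i} ×ˢ ({i}ᶜ : Finset (Fin n)),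
        outcome (x.2 ∈ A) (if x.2 ∈ nbrs q ω x.1 then (1 : ℝ) else 0) := by
    intro ω
    have hsub : nbrs q ω i ⊆ ({i}ᶜ : Finset (Fin n)) := by
      intro j hj
      simp only [nbrs, Finset.mem_filter] at hj
      simpa using hj.2.1.symm
    conv_lhs => rw [← Finset.inter_eq_left.2 hsub]
    rw [indicator_card_inter_eq]
    refine Finset.sum_congr rfl fun A _ => ?_
    rw [Finset.prod_product, Finset.prod_singleton]
  have hterm : ∀ A ∈ ({i}ᶜ : Finset (Fin n)).powersetCard d,
      mean n K P p (fun ω => ∏ x ∈ {i} ×ˢ ({i}ᶜ : Finset (Fin n)),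
        outcome (x.2 ∈ A) (if x.2 ∈ nbrs q ω x.1 then (1 : ℝ) else 0))
      = peq q K P p ^ d * (1 - peq q K P p) ^ (n - 1 - d) := by
    intro A hA
    rw [Finset.mem_powersetCard] at hA
    rw [mean_prod_outcome q n K P p {i} {i}ᶜ disjoint_compl_right (fun _ => A)]
    simp_rw [Finset.prod_product, Finset.prod_singleton]
    rw [sum_prod_mul_star (ringWeight K P) (sum_ringWeight K P hKP) i _ (by simp)
      (fun j s t => outcome (j ∈ A) (p * share q s t))]
    have : ∀ s, ringWeight K P s * ∏ j ∈ ({i}ᶜ : Finset (Fin n)), ∑ t, ringWeight K P t *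
        outcome (j ∈ A) (p * share q s t) = ringWeight K P s *
          (peq q K P p ^ d * (1 - peq q K P p) ^ (n - 1 - d)) := by
      intro s
      by_cases hs : s.card = K
      · simp_rw [sum_ringWeight_outcome q K P p hKP hqK _ s hs]
        rw [prod_outcome_mem _ _ hA.1, hA.2, hJ]
      · simp [ringWeight, hs]
    rw [Finset.sum_congr rfl fun s _ => this s, ← Finset.sum_mul, sum_ringWeight K P hKP, one_mul]
  simp_rw [h1]
  simp only [mean] at hterm ⊢
  simp_rw [Finset.mul_sum]
  rw [Finset.sum_comm, Finset.sum_congr rfl hterm, Finset.sum_const, Finset.card_powersetCard, hJ,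
    nsmul_eq_mul, mul_assoc]

/-- The probability of a joint outcome for two indicators with mean `x` and product mean `a`. -/
noncomputable def jointOutcome (B B' : Prop) [Decidable B] [Decidable B'] (a x : ℝ) : ℝ :=
  if B then (if B' then a else x - a) else (if B' then x - a else 1 - 2 * x + a)

theorem sum_ringWeight_outcome_mul_outcome (q K P : ℕ) (p : ℝ) (hKP : K ≤ P) (hqK : q ≤ K)
    (B B' : Prop) [Decidable B] [Decidable B'] (s s' : Finset (Fin P)) (hs : s.card = K)
    (hs' : s'.card = K) :
    ∑ t, ringWeight K P t * (outcome B (p * share q s t) * outcome B' (p * share q s' t))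
      = jointOutcome B B' (p ^ 2 * overlap q K P s s') (peq q K P p) := by
  have h0 := sum_ringWeight K P hKP
  have h1 : ∑ t, ringWeight K P t * (p * share q s t) = peq q K P p := by
    rw [peq, ← sum_ringWeight_share q K P hKP hqK s hs, Finset.mul_sum]
    exact Finset.sum_congr rfl fun t _ => by ring
  have h2 : ∑ t, ringWeight K P t * (p * share q s' t) = peq q K P p := by
    rw [peq, ← sum_ringWeight_share q K P hKP hqK s' hs', Finset.mul_sum]
    exact Finset.sum_congr rfl fun t _ => by ring
  have h3 : ∑ t, ringWeight K P t * ((p * share q s t) * (p * share q s' t))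
      = p ^ 2 * overlap q K P s s' := by
    rw [overlap, Finset.mul_sum]
    exact Finset.sum_congr rfl fun t _ => by ring
  unfold outcome jointOutcome
  split_ifs
  · exact h3
  · rw [← h3, ← h1, ← Finset.sum_sub_distrib]
    exact Finset.sum_congr rfl fun t _ => by ring
  · rw [← h3, ← h2, ← Finset.sum_sub_distrib]
    exact Finset.sum_congr rfl fun t _ => by ring
  · calc _ = (∑ t, ringWeight K P t) - ∑ t, ringWeight K P t * (p * share q s t)
          - ∑ t, ringWeight K P t * (p * share q s' t)
          + ∑ t, ringWeight K P t * ((p * share q s t) * (p * share q s' t)) := by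
          rw [← Finset.sum_sub_distrib, ← Finset.sum_sub_distrib, ← Finset.sum_add_distrib]
          exact Finset.sum_congr rfl fun t _ => by ring
      _ = _ := by rw [h0, h1, h2, h3]; ring

theorem mean_pair_eq (q n K P : ℕ) (p : ℝ) (hKP : K ≤ P) (hqK : q ≤ K) (i i' : Fin n)
    (hii' : i ≠ i') (d : ℕ) :
    mean n K P p (fun ω => (if (nbrs q ω i ∩ {i, i'}ᶜ).card = d then 1 else 0) *
        (if (nbrs q ω i' ∩ {i, i'}ᶜ).card = d then 1 else 0))
      = ∑ s, ringWeight K P s * ∑ s', ringWeight K P s' *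
        ∑ A ∈ ({i, i'}ᶜ : Finset (Fin n)).powersetCard d,
          ∑ B ∈ ({i, i'}ᶜ : Finset (Fin n)).powersetCard d,
            ∏ j ∈ ({i, i'}ᶜ : Finset (Fin n)),
              jointOutcome (j ∈ A) (j ∈ B) (p ^ 2 * overlap q K P s s') (peq q K P p) := by
  set J : Finset (Fin n) := {i, i'}ᶜ with hJ
  have hi : i ∉ J := by simp [hJ]
  have hi' : i' ∉ J := by simp [hJ]
  have h1 : ∀ ω : Config n P, (if (nbrs q ω i ∩ J).card = d then (1 : ℝ) else 0) *
      (if (nbrs q ω i' ∩ J).card = d then 1 else 0)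
      = ∑ A ∈ J.powersetCard d, ∑ B ∈ J.powersetCard d, ∏ x ∈ {i, i'} ×ˢ J,
        outcome (x.2 ∈ (if x.1 = i then A else B))
          (if x.2 ∈ nbrs q ω x.1 then (1 : ℝ) else 0) := by
    intro ω
    rw [indicator_card_inter_eq, indicator_card_inter_eq, Finset.sum_mul_sum]
    refine Finset.sum_congr rfl fun A _ => Finset.sum_congr rfl fun B _ => ?_
    rw [Finset.prod_product, Finset.prod_pair hii']
    simp [hii'.symm]
  have hterm : ∀ A B : Finset (Fin n),
      mean n K P p (fun ω => ∏ x ∈ {i, i'} ×ˢ J, outcome (x.2 ∈ (if x.1 = i then A else B))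
          (if x.2 ∈ nbrs q ω x.1 then (1 : ℝ) else 0))
      = ∑ s, ringWeight K P s * ∑ s', ringWeight K P s' * ∏ j ∈ J,
          jointOutcome (j ∈ A) (j ∈ B) (p ^ 2 * overlap q K P s s') (peq q K P p) := by
    intro A B
    rw [mean_prod_outcome q n K P p {i, i'} J disjoint_compl_right
      (fun x => if x = i then A else B)]
    simp_rw [Finset.prod_product, Finset.prod_pair hii', if_true, if_neg hii'.symm,
      ← Finset.prod_mul_distrib]
    rw [sum_prod_mul_double_star (ringWeight K P) (sum_ringWeight K P hKP) i i' hii' J hi hi'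
      (fun j s s' t => outcome (j ∈ A) (p * share q s t) * outcome (j ∈ B) (p * share q s' t))]
    refine Finset.sum_congr rfl fun s _ => ?_
    by_cases hs : s.card = K
    · congr 1
      refine Finset.sum_congr rfl fun s' _ => ?_
      by_cases hs' : s'.card = K
      · congr 1
        exact Finset.prod_congr rfl fun j _ =>
          sum_ringWeight_outcome_mul_outcome q K P p hKP hqK _ _ s s' hs hs'
      · simp [ringWeight, hs']
    · simp [ringWeight, hs]
  simp_rw [h1]
  simp only [mean] at hterm ⊢
  simp_rw [Finset.mul_sum]
  rw [Finset.sum_comm]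
  simp_rw [Finset.sum_comm (s := (Finset.univ : Finset (Config n P))), hterm, Finset.mul_sum]
  rw [Finset.sum_congr rfl fun A _ => Finset.sum_comm, Finset.sum_comm]
  refine Finset.sum_congr rfl fun s _ => ?_
  rw [Finset.sum_congr rfl fun A _ => Finset.sum_comm, Finset.sum_comm]

/-- Poisson weight. -/
noncomputable def poissonTerm (d : ℕ) (l : ℝ) : ℝ := l ^ d * Real.exp (-l) / d.factorial

theorem poissonTerm_nonneg (d : ℕ) {l : ℝ} (hl : 0 ≤ l) : 0 ≤ poissonTerm d l := by
  unfold poissonTerm; positivity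

theorem prod_jointOutcome_le {α : Type*} [DecidableEq α] (J A B : Finset α) (hA : A ⊆ J)
    (hB : B ⊆ J) (d : ℕ) (hAd : A.card = d) (hBd : B.card = d) (a x : ℝ) (ha : 0 ≤ a) (hax : a ≤ x)
    (h1 : 0 ≤ 1 - 2 * x + a) :
    ∏ j ∈ J, jointOutcome (j ∈ A) (j ∈ B) a x
      ≤ Real.exp (-(2 * x - a)) ^ J.card * Real.exp (4 * x * d) *
        (a ^ (A ∩ B).card * (x ^ 2) ^ (d - (A ∩ B).card)) := by
  have hx : 0 ≤ x := ha.trans hax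
  set E := Real.exp (-(2 * x - a)) with hE
  set F := Real.exp (2 * x) with hF
  have hEF : 1 ≤ E * F := by
    rw [hE, hF, ← Real.exp_add]
    exact Real.one_le_exp (by linarith)
  have hE0 : 0 < E := Real.exp_pos _
  have hF1 : 1 ≤ F := Real.one_le_exp (by linarith)
  have hF0 : 0 < F := Real.exp_pos _
  have hfac : ∀ j ∈ J, jointOutcome (j ∈ A) (j ∈ B) a x ≤ E *
      ((if j ∈ A ∩ B then a * F else 1) * ((if j ∈ A \ B then x * F else 1) *
        (if j ∈ B \ A then x * F else 1))) := by
    intro j _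
    unfold jointOutcome
    simp only [Finset.mem_inter, Finset.mem_sdiff]
    by_cases hjA : j ∈ A <;> by_cases hjB : j ∈ B <;> simp only [hjA, hjB] <;> simp
    · nlinarith
    · nlinarith
    · nlinarith
    · have := Real.add_one_le_exp (-(2 * x - a))
      rw [← hE] at this
      linarith
  have hi := Finset.card_le_card (Finset.inter_subset_left (s₁ := A) (s₂ := B))
  have hAB : (A \ B).card = d - (A ∩ B).card := by
    have := Finset.card_sdiff_add_card_inter A B
    omega
  have hBA : (B \ A).card = d - (A ∩ B).card := by
    have := Finset.card_sdiff_add_card_inter B A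
    rw [Finset.inter_comm] at this
    omega
  refine (Finset.prod_le_prod (fun j _ => ?_) hfac).trans ?_
  · unfold jointOutcome
    split_ifs <;> linarith
  rw [Finset.prod_mul_distrib, Finset.prod_const, Finset.prod_mul_distrib, Finset.prod_mul_distrib,
    Finset.prod_ite_mem, Finset.prod_ite_mem, Finset.prod_ite_mem,
    Finset.inter_eq_right.2 (Finset.inter_subset_left.trans hA),
    Finset.inter_eq_right.2 (Finset.sdiff_subset.trans hA),
    Finset.inter_eq_right.2 (Finset.sdiff_subset.trans hB), Finset.prod_const, Finset.prod_const,
    Finset.prod_const, hAB, hBA, mul_assoc]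
  refine mul_le_mul_of_nonneg_left ?_ (by positivity)
  set m := (A ∩ B).card
  have h4 : Real.exp (4 * x * d) = F ^ (2 * d) := by
    rw [hF, ← Real.exp_nat_mul]
    congr 1
    push_cast
    ring
  rw [h4]
  have h5 : F ^ (m + 2 * (d - m)) ≤ F ^ (2 * d) := pow_le_pow_right₀ hF1 (by omega)
  calc (a * F) ^ m * ((x * F) ^ (d - m) * (x * F) ^ (d - m))
      = F ^ (m + 2 * (d - m)) * (a ^ m * (x ^ 2) ^ (d - m)) := by
        rw [← pow_mul, mul_pow, mul_pow, pow_add, two_mul, pow_add, pow_add]; ring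
    _ ≤ _ := by gcongr

theorem sum_pow_inter_le {α : Type*} [DecidableEq α] (J : Finset α) (n d : ℕ) (hJ : J.card ≤ n)
    (hn : 0 < n) (a x : ℝ) (ha : 0 ≤ a) (hx : 0 < x) (hd : (d : ℝ) ≤ n * x) :
    ∑ A ∈ J.powersetCard d, ∑ B ∈ J.powersetCard d,
        a ^ (A ∩ B).card * (x ^ 2) ^ (d - (A ∩ B).card)
      ≤ ((n * x) ^ d / d.factorial) ^ 2 * Real.exp (n * a) := by
  have hn0 : (0 : ℝ) < n := by exact_mod_cast hn
  have hinner : ∀ A ∈ J.powersetCard d, ∑ B ∈ J.powersetCard d,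
      a ^ (A ∩ B).card * (x ^ 2) ^ (d - (A ∩ B).card)
      ≤ (d * a + n * x ^ 2) ^ d / d.factorial := by
    intro A hA
    obtain ⟨hAJ, hAd⟩ := Finset.mem_powersetCard.1 hA
    rw [← Finset.sum_fiberwise_of_maps_to (t := Finset.range (d + 1))
      (g := fun B => (A ∩ B).card) (fun B _ => by
        have := Finset.card_le_card (Finset.inter_subset_left (s₁ := A) (s₂ := B))
        rw [Finset.mem_range]; omega), add_pow, Finset.sum_div]
    refine Finset.sum_le_sum fun m hm => ?_
    have hmd : m ≤ d := by have := Finset.mem_range.1 hm; omega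
    rw [Finset.sum_congr rfl (g := fun _ => a ^ m * (x ^ 2) ^ (d - m)) (fun B hB => by
      rw [(Finset.mem_filter.1 hB).2]), Finset.sum_const,
      card_filter_inter_card_eq J A hAJ d m hmd, hAd, nsmul_eq_mul]
    have hch : ((J.card - d).choose (d - m) : ℝ) ≤ (n : ℝ) ^ (d - m) * d ^ m / d.factorial := by
      have hc1 : ((J.card - d).choose (d - m) : ℝ) ≤ (n : ℝ) ^ (d - m) / (d - m).factorial := by
        refine (Nat.choose_le_pow_div (d - m) (J.card - d)).trans ?_
        gcongr
        omega
      refine hc1.trans ?_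
      rw [div_le_div_iff₀ (by positivity) (by positivity), mul_assoc]
      gcongr
      have h1 := Nat.descFactorial_le_pow d m
      have h2 := Nat.factorial_mul_descFactorial hmd
      rw [← h2]
      push_cast
      rw [mul_comm]
      gcongr
      exact_mod_cast h1
    push_cast
    calc (d.choose m : ℝ) * ((J.card - d).choose (d - m)) * (a ^ m * (x ^ 2) ^ (d - m))
        ≤ (d.choose m : ℝ) * ((n : ℝ) ^ (d - m) * d ^ m / d.factorial)
          * (a ^ m * (x ^ 2) ^ (d - m)) := by gcongr
      _ = _ := by
        rw [mul_pow, mul_pow]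
        ring
  refine (Finset.sum_le_sum hinner).trans ?_
  rw [Finset.sum_const, Finset.card_powersetCard, nsmul_eq_mul]
  have hc : (J.card.choose d : ℝ) ≤ (n : ℝ) ^ d / d.factorial := by
    refine (Nat.choose_le_pow_div d J.card).trans ?_
    gcongr
  have hexp : (1 + d * a / (n * x ^ 2)) ^ d ≤ Real.exp (n * a) := by
    calc (1 + d * a / (n * x ^ 2)) ^ d ≤ Real.exp (d * a / (n * x ^ 2)) ^ d := by
          gcongr
          rw [add_comm]
          exact Real.add_one_le_exp _
      _ = Real.exp (d * (d * a / (n * x ^ 2))) := by rw [← Real.exp_nat_mul]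
      _ ≤ _ := by
          refine Real.exp_le_exp.2 ?_
          rw [mul_div_assoc', div_le_iff₀ (by positivity)]
          have : (d : ℝ) * d ≤ (n * x) * (n * x) := by gcongr
          nlinarith
  calc (J.card.choose d : ℝ) * ((d * a + n * x ^ 2) ^ d / d.factorial)
      ≤ (n : ℝ) ^ d / d.factorial * ((d * a + n * x ^ 2) ^ d / d.factorial) := by gcongr
    _ = ((n * x) ^ d / d.factorial) ^ 2 * (1 + d * a / (n * x ^ 2)) ^ d := by
        have : d * a + n * x ^ 2 = (n * x ^ 2) * (1 + d * a / (n * x ^ 2)) := by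
          field_simp
          ring
        rw [this, mul_pow]
        ring
    _ ≤ _ := by gcongr

theorem sum_sum_prod_jointOutcome_le {α : Type*} [DecidableEq α] (J : Finset α) (n d : ℕ)
    (hJ : J.card + 2 = n) (a x : ℝ) (ha : 0 ≤ a) (hax : a ≤ x) (h1 : 0 ≤ 1 - 2 * x + a)
    (hx : 0 < x) (hd : (d : ℝ) ≤ n * x) :
    ∑ A ∈ J.powersetCard d, ∑ B ∈ J.powersetCard d, ∏ j ∈ J, jointOutcome (j ∈ A) (j ∈ B) a x
      ≤ poissonTerm d (n * x) ^ 2 * Real.exp (4 * x * (d + 1)) * Real.exp (2 * (n * a)) := by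
  calc ∑ A ∈ J.powersetCard d, ∑ B ∈ J.powersetCard d, ∏ j ∈ J, jointOutcome (j ∈ A) (j ∈ B) a x
      ≤ ∑ A ∈ J.powersetCard d, ∑ B ∈ J.powersetCard d,
        Real.exp (-(2 * x - a)) ^ J.card * Real.exp (4 * x * d) *
        (a ^ (A ∩ B).card * (x ^ 2) ^ (d - (A ∩ B).card)) := by
        refine Finset.sum_le_sum fun A hA => Finset.sum_le_sum fun B hB => ?_
        rw [Finset.mem_powersetCard] at hA hB
        exact prod_jointOutcome_le J A B hA.1 hB.1 d hA.2 hB.2 a x ha hax h1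
    _ = Real.exp (-(2 * x - a)) ^ J.card * Real.exp (4 * x * d) *
        ∑ A ∈ J.powersetCard d, ∑ B ∈ J.powersetCard d,
          a ^ (A ∩ B).card * (x ^ 2) ^ (d - (A ∩ B).card) := by
        simp_rw [Finset.mul_sum]
    _ ≤ Real.exp (-(2 * x - a)) ^ J.card * Real.exp (4 * x * d) *
        (((n * x) ^ d / d.factorial) ^ 2 * Real.exp (n * a)) := by
        gcongr
        exact sum_pow_inter_le J n d (by omega) (by omega) a x ha hx hd
    _ ≤ _ := by
        have hcard : (J.card : ℝ) = n - 2 := by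
          rw [← hJ]; push_cast; ring
        have key : Real.exp (-(2 * x - a)) ^ J.card * Real.exp (4 * x * d) * Real.exp (n * a)
            ≤ Real.exp (-(n * x)) ^ 2 * Real.exp (4 * x * (d + 1)) * Real.exp (2 * (n * a)) := by
          rw [← Real.exp_nat_mul, ← Real.exp_nat_mul, ← Real.exp_add, ← Real.exp_add,
            ← Real.exp_add, ← Real.exp_add, hcard]
          refine Real.exp_le_exp.2 ?_
          push_cast
          nlinarith
        unfold poissonTerm
        calc _ = ((n * x) ^ d / d.factorial) ^ 2 * (Real.exp (-(2 * x - a)) ^ J.card *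
              Real.exp (4 * x * d) * Real.exp (n * a)) := by ring
          _ ≤ ((n * x) ^ d / d.factorial) ^ 2 * (Real.exp (-(n * x)) ^ 2 *
              Real.exp (4 * x * (d + 1)) * Real.exp (2 * (n * a))) := by gcongr
          _ = _ := by ring

/-! ### Exponential moment of the overlap of two key rings -/

/-- Exponential moment of the probability of being adjacent to two given vertices. -/
noncomputable def expMoment (q n K P : ℕ) (p : ℝ) : ℝ :=
  ∑ s, ringWeight K P s * ∑ s', ringWeight K P s' *
    Real.exp (2 * (n * (p ^ 2 * overlap q K P s s')))

theorem exp_overlap_le (q n K P L : ℕ) (p : ℝ) (hq : 1 ≤ q) (hKP : K ≤ P) (hqK : 2 * q ≤ K)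
    (hLK : L ≤ K) (hp0 : 0 ≤ p) (hp1 : p ≤ 1) (hx : (K : ℝ) ^ 2 / P ≤ 1 / 4)
    (s s' : Finset (Fin P)) (hs : s.card = K) (hs' : s'.card = K) :
    Real.exp (2 * (n * (p ^ 2 * overlap q K P s s')))
      ≤ 1 + 2 * n * p ^ 2 * Real.exp (2 * (n * peq q K P p) *
          ((2 ^ (q + 1) * ((K : ℝ) ^ 2 / P) + L / K) / psqConst q)) * overlap q K P s s'
        + Real.exp (2 * (n * peq q K P p) * p) * share L s s' := by
  have hov := overlap_nonneg q K P s s'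
  have hK0 : (0 : ℝ) < K := by exact_mod_cast (show 0 < K by omega)
  have hc := psqConst_pos q
  have hx0 : 0 ≤ (K : ℝ) ^ 2 / P := by positivity
  set x := (K : ℝ) ^ 2 / P with hxdef
  by_cases hL : L ≤ (s ∩ s').card
  · have h1 : share L s s' = 1 := if_pos hL
    rw [h1, mul_one]
    have h2 : Real.exp (2 * (n * (p ^ 2 * overlap q K P s s')))
        ≤ Real.exp (2 * (n * peq q K P p) * p) := by
      refine Real.exp_le_exp.2 ?_
      have := overlap_le_psq q K P hKP (by omega) s s' hs
      calc 2 * (n * (p ^ 2 * overlap q K P s s')) ≤ 2 * (n * (p ^ 2 * psq q K P)) := by gcongr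
        _ = _ := by rw [peq]; ring
    have h3 : 0 ≤ 2 * n * p ^ 2 * Real.exp (2 * (n * peq q K P p) *
          ((2 ^ (q + 1) * x + L / K) / psqConst q)) * overlap q K P s s' := by positivity
    linarith
  · have h1 : share L s s' = 0 := if_neg hL
    rw [h1, mul_zero, add_zero]
    push Not at hL
    have h2 : overlap q K P s s' ≤ psq q K P * ((2 ^ (q + 1) * x + L / K) / psqConst q) := by
      have h3 : ((s ∩ s').card * (K / P) : ℝ) ≤ (L / K) * x := by
        have : ((L : ℝ) / K) * x = L * (K / P) := by
          rw [hxdef]; field_simp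
        rw [this]
        gcongr
      have h4 : ((L : ℝ) / K) ^ q ≤ L / K := by
        refine pow_le_of_le_one (by positivity) ?_ (by omega)
        rw [div_le_one hK0]
        exact_mod_cast hLK
      calc overlap q K P s s' ≤ (2 * x) ^ (q + 1) + ((s ∩ s').card * (K / P) : ℝ) ^ q :=
            overlap_le q K P hKP s s' hs hs'
        _ ≤ (2 * x) ^ (q + 1) + ((L / K) * x) ^ q := by gcongr
        _ ≤ (2 * x) ^ (q + 1) + (L / K) * x ^ q := by
            rw [mul_pow ((L : ℝ) / K)]
            gcongr
        _ = (psqConst q * x ^ q) * ((2 ^ (q + 1) * x + L / K) / psqConst q) := by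
            field_simp
            ring
        _ ≤ _ := by
            gcongr
            exact le_psq q K P hKP hqK (by omega) hx
    have hps := psq_nonneg q K P hKP (by omega)
    set η := (2 ^ (q + 1) * x + L / K) / psqConst q with hη
    have hη0 : 0 ≤ η := by positivity
    set t := 2 * (n * (p ^ 2 * overlap q K P s s')) with ht
    have ht0 : 0 ≤ t := by positivity
    have h5 : t ≤ 2 * (n * peq q K P p) * η := by
      calc t ≤ 2 * (n * (p ^ 2 * (psq q K P * η))) := by rw [ht]; gcongr
        _ ≤ 2 * (n * (p * (psq q K P * η))) := by
            gcongr
            exact pow_le_of_le_one hp0 hp1 two_ne_zero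
        _ = _ := by rw [peq]; ring
    have h6 : Real.exp t ≤ 1 + t * Real.exp t := by
      have h7 := Real.add_one_le_exp (-t)
      have h8 : Real.exp (-t) * Real.exp t = 1 := by rw [← Real.exp_add]; simp
      nlinarith [Real.exp_pos t]
    calc Real.exp t ≤ 1 + t * Real.exp t := h6
      _ ≤ 1 + t * Real.exp (2 * (n * peq q K P p) * η) := by gcongr
      _ = _ := by rw [ht]; ring

theorem expMoment_le (q n K P L : ℕ) (p : ℝ) (hq : 1 ≤ q) (hKP : K ≤ P) (hqK : 2 * q ≤ K)
    (hLK : L ≤ K) (hp0 : 0 ≤ p) (hp1 : p ≤ 1) (hx : (K : ℝ) ^ 2 / P ≤ 1 / 4) (hn : 0 < n) :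
    expMoment q n K P p
      ≤ 1 + 2 * ((n * peq q K P p) ^ 2 / n) * Real.exp (2 * (n * peq q K P p) *
          ((2 ^ (q + 1) * ((K : ℝ) ^ 2 / P) + L / K) / psqConst q))
        + Real.exp (2 * (n * peq q K P p) * p) * ((K : ℝ) ^ 2 / P) ^ L := by
  set E := Real.exp (2 * (n * peq q K P p) *
          ((2 ^ (q + 1) * ((K : ℝ) ^ 2 / P) + L / K) / psqConst q))
  set F := Real.exp (2 * (n * peq q K P p) * p)
  have h1 := sum_ringWeight K P hKP
  have hn0 : (n : ℝ) ≠ 0 := by exact_mod_cast hn.ne'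
  calc expMoment q n K P p
      ≤ ∑ s, ringWeight K P s * ∑ s', ringWeight K P s' *
          (1 + 2 * n * p ^ 2 * E * overlap q K P s s' + F * share L s s') := by
        refine Finset.sum_le_sum fun s _ => ?_
        by_cases hs : s.card = K
        · refine mul_le_mul_of_nonneg_left (Finset.sum_le_sum fun s' _ => ?_)
            (ringWeight_nonneg K P s)
          by_cases hs' : s'.card = K
          · exact mul_le_mul_of_nonneg_left
              (exp_overlap_le q n K P L p hq hKP hqK hLK hp0 hp1 hx s s' hs hs')
              (ringWeight_nonneg K P s')
          · simp [ringWeight, hs']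
        · simp [ringWeight, hs]
    _ = 1 + 2 * n * p ^ 2 * E * psq q K P ^ 2
          + F * ∑ s, ringWeight K P s * ∑ s', ringWeight K P s' * share L s s' := by
        rw [← sum_sum_ringWeight_overlap q K P hKP (by omega)]
        simp_rw [mul_add, Finset.sum_add_distrib, mul_add, Finset.sum_add_distrib, mul_one, h1]
        simp only [mul_one, h1]
        congr 1
        · congr 1
          simp_rw [Finset.mul_sum]
          exact Finset.sum_congr rfl fun _ _ => Finset.sum_congr rfl fun _ _ => by ring
        · simp_rw [Finset.mul_sum]
          exact Finset.sum_congr rfl fun _ _ => Finset.sum_congr rfl fun _ _ => by ring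
    _ ≤ 1 + 2 * n * p ^ 2 * E * psq q K P ^ 2 + F * ((K : ℝ) ^ 2 / P) ^ L := by
        have : ∑ s, ringWeight K P s * ∑ s', ringWeight K P s' * share L s s'
            ≤ ∑ s, ringWeight K P s * ((K : ℝ) ^ 2 / P) ^ L := by
          refine Finset.sum_le_sum fun s _ => ?_
          by_cases hs : s.card = K
          · refine mul_le_mul_of_nonneg_left ?_ (ringWeight_nonneg K P s)
            have := sum_ringWeight_share_le K P L hKP s
            rwa [hs, show (K : ℝ) * (K / P) = (K : ℝ) ^ 2 / P by ring] at this
          · simp [ringWeight, hs]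
        rw [← Finset.sum_mul, h1, one_mul] at this
        gcongr
    _ = _ := by
        rw [peq]
        congr 2
        field_simp

/-! ### First and second moments -/

theorem weight_nonneg (n K P : ℕ) (p : ℝ) (hp0 : 0 ≤ p) (hp1 : p ≤ 1) (ω : Config n P) :
    0 ≤ weight n K P p ω := by
  unfold weight
  refine mul_nonneg (Finset.prod_nonneg fun i _ => ?_) (Finset.prod_nonneg fun e _ => ?_)
  · split_ifs <;> positivity
  · split_ifs <;> linarith

theorem sum_weight (n K P : ℕ) (p : ℝ) (hKP : K ≤ P) : ∑ ω, weight n K P p ω = 1 := by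
  have h := mean_prod_outcome 0 n K P p ∅ ∅ (Finset.disjoint_empty_left _) fun _ => ∅
  have h' := sum_prod_mul_prod_comp (ι := Fin n) (κ := Fin n) (ringWeight K P)
    (sum_ringWeight K P hKP) ∅ id (Function.injective_id.injOn) fun _ _ => 1
  simp only [mean, Finset.product_empty, Finset.prod_empty, mul_one] at h h'
  rw [h, h']

theorem mean_mono {n K P : ℕ} {p : ℝ} (hp0 : 0 ≤ p) (hp1 : p ≤ 1) {f g : Config n P → ℝ}
    (h : ∀ ω, f ω ≤ g ω) : mean n K P p f ≤ mean n K P p g :=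
  Finset.sum_le_sum fun ω _ => mul_le_mul_of_nonneg_left (h ω) (weight_nonneg n K P p hp0 hp1 ω)

theorem mean_add (n K P : ℕ) (p : ℝ) (f g : Config n P → ℝ) :
    mean n K P p (fun ω => f ω + g ω) = mean n K P p f + mean n K P p g := by
  simp only [mean, mul_add, Finset.sum_add_distrib]

theorem mean_sum {ι : Type*} (F : Finset ι) (n K P : ℕ) (p : ℝ) (f : ι → Config n P → ℝ) :
    mean n K P p (fun ω => ∑ i ∈ F, f i ω) = ∑ i ∈ F, mean n K P p (f i) := by
  simp only [mean, Finset.mul_sum]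
  exact Finset.sum_comm

theorem mean_const_mul (n K P : ℕ) (p c : ℝ) (f : Config n P → ℝ) :
    mean n K P p (fun ω => c * f ω) = c * mean n K P p f := by
  simp only [mean, Finset.mul_sum]
  exact Finset.sum_congr rfl fun _ _ => by ring

theorem mean_const (n K P : ℕ) (p c : ℝ) (hKP : K ≤ P) :
    mean n K P p (fun _ => c) = c := by
  rw [mean, ← Finset.sum_mul, sum_weight n K P p hKP, one_mul]

theorem mem_nbrs_comm (q : ℕ) {n P : ℕ} (ω : Config n P) (i j : Fin n) :
    j ∈ nbrs q ω i ↔ i ∈ nbrs q ω j := by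
  simp only [nbrs, Finset.mem_filter, Finset.mem_univ, true_and]
  rw [ne_comm, Finset.inter_comm, Sym2.eq_swap]

theorem notMem_nbrs_self (q : ℕ) {n P : ℕ} (ω : Config n P) (i : Fin n) : i ∉ nbrs q ω i := by
  simp [nbrs]

theorem card_nbrs_eq (q : ℕ) {n P : ℕ} (ω : Config n P) (i i' : Fin n) :
    (nbrs q ω i).card = (nbrs q ω i ∩ {i, i'}ᶜ).card + if i' ∈ nbrs q ω i then 1 else 0 := by
  have h1 : nbrs q ω i ∩ {i, i'}ᶜ = (nbrs q ω i).erase i' := by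
    ext j
    simp only [Finset.mem_inter, Finset.mem_compl, Finset.mem_insert, Finset.mem_singleton,
      Finset.mem_erase, not_or]
    constructor
    · rintro ⟨h, -, h'⟩
      exact ⟨h', h⟩
    · rintro ⟨h, h'⟩
      exact ⟨h', fun e => notMem_nbrs_self q ω i (e ▸ h'), h⟩
  rw [h1]
  split_ifs with h
  · rw [Finset.card_erase_add_one h]
  · rw [Finset.erase_eq_of_notMem h, add_zero]

/-- Indicator that a vertex has degree `d`. -/
noncomputable def degInd (q d : ℕ) {n P : ℕ} (i : Fin n) (ω : Config n P) : ℝ :=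
  if (nbrs q ω i).card = d then 1 else 0

theorem degInd_nonneg (q d : ℕ) {n P : ℕ} (i : Fin n) (ω : Config n P) : 0 ≤ degInd q d i ω := by
  unfold degInd; split_ifs <;> norm_num

/-- Probability that two given vertices both have `d` neighbours among the other vertices. -/
noncomputable def pairProb (q n K P : ℕ) (p : ℝ) (i i' : Fin n) (d : ℕ) : ℝ :=
  mean n K P p (fun ω => (if (nbrs q ω i ∩ {i, i'}ᶜ).card = d then 1 else 0) *
        (if (nbrs q ω i' ∩ {i, i'}ᶜ).card = d then 1 else 0))

theorem pairProb_le (q n K P : ℕ) (p : ℝ) (hKP : K ≤ P) (hqK : q ≤ K) (hp0 : 0 ≤ p) (hp1 : p ≤ 1)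
    (i i' : Fin n) (hii' : i ≠ i') (d : ℕ) (hpe0 : 0 < peq q K P p) (hpe : peq q K P p ≤ 1 / 2)
    (hd : (d : ℝ) ≤ n * peq q K P p) :
    pairProb q n K P p i i' d ≤ poissonTerm d (n * peq q K P p) ^ 2 *
      Real.exp (4 * peq q K P p * (d + 1)) * expMoment q n K P p := by
  rw [pairProb, mean_pair_eq q n K P p hKP hqK i i' hii' d, expMoment]
  simp_rw [Finset.mul_sum]
  refine Finset.sum_le_sum fun s _ => Finset.sum_le_sum fun s' _ => ?_
  by_cases hs : s.card = K
  · have hJ : ({i, i'}ᶜ : Finset (Fin n)).card + 2 = n := by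
      have h2 := Finset.card_pair hii'
      have h3 := Finset.card_add_card_compl ({i, i'} : Finset (Fin n))
      rw [h2, Fintype.card_fin] at h3
      omega
    have hov := overlap_nonneg q K P s s'
    have ha : p ^ 2 * overlap q K P s s' ≤ peq q K P p := by
      have := overlap_le_psq q K P hKP hqK s s' hs
      rw [peq]
      calc p ^ 2 * overlap q K P s s' ≤ p * overlap q K P s s' := by
            gcongr
            exact pow_le_of_le_one hp0 hp1 two_ne_zero
        _ ≤ _ := by gcongr
    have hmain := sum_sum_prod_jointOutcome_le ({i, i'}ᶜ : Finset (Fin n)) n d hJ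
      (p ^ 2 * overlap q K P s s') (peq q K P p) (by positivity) ha
      (by nlinarith [mul_nonneg (sq_nonneg p) hov]) hpe0 hd
    have hw := ringWeight_nonneg K P s
    have hw' := ringWeight_nonneg K P s'
    have := mul_le_mul_of_nonneg_left (mul_le_mul_of_nonneg_left hmain hw') hw
    simp_rw [Finset.mul_sum] at this
    refine this.trans (le_of_eq (by ring))
  · simp [ringWeight, hs]

theorem degInd_mul_degInd_le (q m : ℕ) {n P : ℕ} (i i' : Fin n) (ω : Config n P) :
    degInd q m i ω * degInd q m i' ω
      ≤ (if (nbrs q ω i ∩ {i, i'}ᶜ).card = m then 1 else 0) *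
          (if (nbrs q ω i' ∩ {i, i'}ᶜ).card = m then 1 else 0)
        + (if m = 0 then 0 else 1) * ((if (nbrs q ω i ∩ {i, i'}ᶜ).card = m - 1 then 1 else 0) *
          (if (nbrs q ω i' ∩ {i, i'}ᶜ).card = m - 1 then 1 else 0)) := by
  have h1 := card_nbrs_eq q ω i i'
  have h2 := card_nbrs_eq q ω i' i
  rw [Finset.pair_comm i' i] at h2
  have h3 := mem_nbrs_comm q ω i i'
  unfold degInd
  by_cases hm : (nbrs q ω i).card = m ∧ (nbrs q ω i').card = m
  · by_cases hadj : i' ∈ nbrs q ω i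
    · rw [if_pos hadj] at h1
      rw [if_pos (h3.1 hadj)] at h2
      have e0 : m ≠ 0 := by omega
      have e1 : (nbrs q ω i ∩ {i, i'}ᶜ).card = m - 1 := by omega
      have e2 : (nbrs q ω i' ∩ {i, i'}ᶜ).card = m - 1 := by omega
      rw [if_pos hm.1, if_pos hm.2, if_neg e0, if_pos e1, if_pos e2]
      have : (0 : ℝ) ≤ (if (nbrs q ω i ∩ {i, i'}ᶜ).card = m then 1 else 0) *
          (if (nbrs q ω i' ∩ {i, i'}ᶜ).card = m then 1 else 0) := by positivity
      linarith
    · rw [if_neg hadj] at h1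
      rw [if_neg (fun h => hadj (h3.2 h))] at h2
      have e1 : (nbrs q ω i ∩ {i, i'}ᶜ).card = m := by omega
      have e2 : (nbrs q ω i' ∩ {i, i'}ᶜ).card = m := by omega
      rw [if_pos hm.1, if_pos hm.2, if_pos e1, if_pos e2]
      have : (0 : ℝ) ≤ (if m = 0 then 0 else 1) *
          ((if (nbrs q ω i ∩ {i, i'}ᶜ).card = m - 1 then 1 else 0) *
          (if (nbrs q ω i' ∩ {i, i'}ᶜ).card = m - 1 then 1 else 0)) := by positivity
      linarith
  · have : (if (nbrs q ω i).card = m then (1 : ℝ) else 0) *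
        (if (nbrs q ω i').card = m then 1 else 0) = 0 := by
      rw [not_and_or] at hm
      rcases hm with h | h <;> simp [h]
    rw [this]
    positivity

theorem mean_degInd_mul_degInd_le (q n K P m : ℕ) (p : ℝ) (hKP : K ≤ P) (hqK : q ≤ K)
    (hp0 : 0 ≤ p) (hp1 : p ≤ 1) (i i' : Fin n) (hii' : i ≠ i') (hpe0 : 0 < peq q K P p)
    (hpe : peq q K P p ≤ 1 / 2) (hm : (m : ℝ) ≤ n * peq q K P p) (hn : 0 < n) :
    mean n K P p (fun ω => degInd q m i ω * degInd q m i' ω)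
      ≤ poissonTerm m (n * peq q K P p) ^ 2 * (1 + (m / (n * peq q K P p)) ^ 2) *
        Real.exp (4 * peq q K P p * (m + 1)) * expMoment q n K P p := by
  set l := n * peq q K P p with hl
  have hl0 : 0 < l := by
    have : (0 : ℝ) < n := by exact_mod_cast hn
    positivity
  have hΦ : 0 ≤ expMoment q n K P p :=
    Finset.sum_nonneg fun s _ => mul_nonneg (ringWeight_nonneg _ _ _) <|
      Finset.sum_nonneg fun s' _ => mul_nonneg (ringWeight_nonneg _ _ _) (Real.exp_pos _).le
  refine (mean_mono hp0 hp1 (degInd_mul_degInd_le q m i i')).trans ?_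
  rw [mean_add, mean_const_mul]
  have h1 := pairProb_le q n K P p hKP hqK hp0 hp1 i i' hii' m hpe0 hpe hm
  unfold pairProb at h1
  refine (add_le_add_left h1 _).trans ?_
  rcases Nat.eq_zero_or_pos m with h0 | h0
  · subst h0
    simp [← hl]
  · obtain ⟨r, rfl⟩ : ∃ r, m = r + 1 := ⟨m - 1, by omega⟩
    have h2 := pairProb_le q n K P p hKP hqK hp0 hp1 i i' hii' r hpe0 hpe
      (by push_cast at hm; linarith)
    unfold pairProb at h2
    rw [if_neg (by omega), one_mul, Nat.add_sub_cancel]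
    refine (add_le_add_right h2 _).trans ?_
    rw [← hl]
    have h3 : poissonTerm r l = poissonTerm (r + 1) l * (((r + 1 : ℕ) : ℝ) / l) := by
      unfold poissonTerm
      rw [Nat.factorial_succ]
      push_cast
      field_simp
      ring
    have h4 : Real.exp (4 * peq q K P p * (r + 1))
        ≤ Real.exp (4 * peq q K P p * (((r + 1 : ℕ) : ℝ) + 1)) := by
      refine Real.exp_le_exp.2 ?_
      push_cast
      nlinarith
    rw [h3]
    calc _ ≤ poissonTerm (r + 1) l ^ 2 * Real.exp (4 * peq q K P p * (((r + 1 : ℕ) : ℝ) + 1)) *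
            expMoment q n K P p
          + (poissonTerm (r + 1) l * (((r + 1 : ℕ) : ℝ) / l)) ^ 2 *
            Real.exp (4 * peq q K P p * (((r + 1 : ℕ) : ℝ) + 1)) * expMoment q n K P p := by
          gcongr
      _ = _ := by ring

theorem minDeg_eq_of_degrees (q n P m : ℕ) (ω : Config n P)
    (h1 : ∀ i, m ≤ (nbrs q ω i).card) (h2 : ∃ i, (nbrs q ω i).card = m) :
    minDeg q n P ω = m := by
  obtain ⟨i, hi⟩ := h2
  unfold minDeg
  simp_rw [degree_eq_card_nbrs]
  refine le_antisymm (Nat.sInf_le ⟨i, hi⟩) ?_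
  refine le_csInf ⟨_, ⟨i, rfl⟩⟩ ?_
  rintro _ ⟨j, rfl⟩
  exact h1 j

theorem one_sub_prob_le (q n K P m : ℕ) (p P₁ P₂ : ℝ) (hKP : K ≤ P) (hp0 : 0 ≤ p) (hp1 : p ≤ 1)
    (hn : 0 < n) (hP₁ : 0 < P₁) (hP₂ : 0 ≤ P₂)
    (h1 : ∀ i : Fin n, mean n K P p (degInd q m i) = P₁)
    (h2 : ∀ i i' : Fin n, i ≠ i' → mean n K P p (fun ω => degInd q m i ω * degInd q m i' ω) ≤ P₂) :
    1 - prob n K P p {ω | minDeg q n P ω = m}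
      ≤ (∑ d ∈ Finset.range m, ∑ i : Fin n, mean n K P p (degInd q d i))
        + (1 / (n * P₁) + (P₂ / P₁ ^ 2 - 1)) := by
  classical
  have hn0 : (0 : ℝ) < n := by exact_mod_cast hn
  set X : Config n P → ℝ := fun ω => ∑ i : Fin n, degInd q m i ω with hX
  have hprob : prob n K P p {ω | minDeg q n P ω = m}
      = mean n K P p (fun ω => if minDeg q n P ω = m then 1 else 0) := by
    unfold prob mean
    refine Finset.sum_congr rfl fun ω _ => ?_
    rw [Set.indicator_apply]
    simp
  have hpt : ∀ ω : Config n P, 1 - (∑ d ∈ Finset.range m, ∑ i : Fin n, degInd q d i ω)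
      ≤ (if minDeg q n P ω = m then (1 : ℝ) else 0) + ((n * P₁)⁻¹ * X ω - 1) ^ 2 := by
    intro ω
    have hsum0 : ∀ d ∈ Finset.range m, 0 ≤ ∑ i : Fin n, degInd q d i ω := fun d _ =>
      Finset.sum_nonneg fun i _ => degInd_nonneg q d i ω
    have hsum := Finset.sum_nonneg hsum0
    have hsq := sq_nonneg ((n * P₁)⁻¹ * X ω - 1)
    by_cases ha : ∀ i, m ≤ (nbrs q ω i).card
    · by_cases hb : ∃ i, (nbrs q ω i).card = m
      · rw [if_pos (minDeg_eq_of_degrees q n P m ω ha hb)]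
        linarith
      · have hX0 : X ω = 0 := by
          push Not at hb
          rw [hX]
          exact Finset.sum_eq_zero fun i _ => if_neg (hb i)
        rw [hX0]
        have : (0 : ℝ) ≤ if minDeg q n P ω = m then (1 : ℝ) else 0 := by positivity
        nlinarith
    · push Not at ha
      obtain ⟨i, hi⟩ := ha
      have hge : (1 : ℝ) ≤ ∑ d ∈ Finset.range m, ∑ i : Fin n, degInd q d i ω := by
        have hd := Finset.single_le_sum hsum0 (Finset.mem_range.2 hi)
        have hi' := Finset.single_le_sum (f := fun j => degInd q (nbrs q ω i).card j ω)
          (fun j _ => degInd_nonneg q _ j ω) (Finset.mem_univ i)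
        have : degInd q (nbrs q ω i).card i ω = 1 := if_pos rfl
        simp only [this] at hi'
        exact hi'.trans hd
      have : (0 : ℝ) ≤ if minDeg q n P ω = m then (1 : ℝ) else 0 := by positivity
      linarith
  have hEX : mean n K P p X = n * P₁ := by
    rw [hX, mean_sum, Finset.sum_congr rfl fun i _ => h1 i]
    simp
  have hEX2 : mean n K P p (fun ω => X ω ^ 2) ≤ n * P₁ + n ^ 2 * P₂ := by
    have e1 : (fun ω => X ω ^ 2)
        = fun ω => ∑ i : Fin n, ∑ i' : Fin n, degInd q m i ω * degInd q m i' ω := by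
      funext ω
      rw [sq, hX, Finset.sum_mul_sum]
    rw [e1, mean_sum]
    simp_rw [mean_sum]
    calc ∑ i : Fin n, ∑ i' : Fin n, mean n K P p (fun ω => degInd q m i ω * degInd q m i' ω)
        ≤ ∑ i : Fin n, ∑ i' : Fin n, ((if i = i' then P₁ else 0) + P₂) := by
          refine Finset.sum_le_sum fun i _ => Finset.sum_le_sum fun i' _ => ?_
          by_cases hii' : i = i'
          · subst hii'
            have e2 : (fun ω : Config n P => degInd q m i ω * degInd q m i ω) = degInd q m i := by
              funext ω
              unfold degInd
              split_ifs <;> simp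
            rw [e2, h1, if_pos rfl]
            linarith
          · rw [if_neg hii', zero_add]
            exact h2 i i' hii'
      _ = _ := by
          simp [Finset.sum_add_distrib]
          ring
  have hvar : mean n K P p (fun ω => ((n * P₁)⁻¹ * X ω - 1) ^ 2)
      ≤ 1 / (n * P₁) + (P₂ / P₁ ^ 2 - 1) := by
    have e1 : (fun ω => ((n * P₁)⁻¹ * X ω - 1) ^ 2)
        = fun ω => ((n * P₁)⁻¹ ^ 2 * X ω ^ 2 + (-2 * (n * P₁)⁻¹) * X ω) + 1 := by
      funext ω
      ring
    rw [e1, mean_add, mean_add, mean_const_mul, mean_const_mul, mean_const n K P p 1 hKP, hEX]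
    calc _ ≤ (n * P₁)⁻¹ ^ 2 * (n * P₁ + n ^ 2 * P₂) + (-2 * (n * P₁)⁻¹) * (n * P₁) + 1 := by
          gcongr
      _ = _ := by
          field_simp
          ring
  have hmain := mean_mono (K := K) (p := p) hp0 hp1 hpt
  rw [mean_add, ← hprob] at hmain
  have hsub : mean n K P p (fun ω => 1 - ∑ d ∈ Finset.range m, ∑ i : Fin n, degInd q d i ω)
      = 1 - ∑ d ∈ Finset.range m, ∑ i : Fin n, mean n K P p (degInd q d i) := by
    have e1 : (fun ω : Config n P => 1 - ∑ d ∈ Finset.range m, ∑ i : Fin n, degInd q d i ω)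
        = fun ω => 1 + (-1) * ∑ d ∈ Finset.range m, ∑ i : Fin n, degInd q d i ω := by
      funext ω
      ring
    rw [e1, mean_add, mean_const n K P p 1 hKP, mean_const_mul, mean_sum]
    simp_rw [mean_sum]
    ring
  rw [hsub] at hmain
  linarith

/-! ### Poisson approximation of the binomial weights -/

theorem binomial_le_poissonTerm (n d : ℕ) (x : ℝ) (hn : 0 < n) (hx0 : 0 ≤ x) (hx1 : x ≤ 1) :
    (n - 1).choose d * x ^ d * (1 - x) ^ (n - 1 - d)
      ≤ poissonTerm d (n * x) * Real.exp (x * (d + 1)) := by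
  have h1 : ((n - 1).choose d : ℝ) ≤ (n : ℝ) ^ d / d.factorial := by
    refine (Nat.choose_le_pow_div d (n - 1)).trans ?_
    gcongr
    omega
  have h0 : 0 ≤ 1 - x := by linarith
  have h2 : (1 - x) ^ (n - 1 - d) ≤ Real.exp (-(n * x)) * Real.exp (x * (d + 1)) := by
    calc (1 - x) ^ (n - 1 - d) ≤ Real.exp (-x) ^ (n - 1 - d) := by
          gcongr
          have := Real.add_one_le_exp (-x)
          linarith
      _ = Real.exp (((n - 1 - d : ℕ) : ℝ) * -x) := (Real.exp_nat_mul _ _).symm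
      _ ≤ _ := by
          rw [← Real.exp_add]
          refine Real.exp_le_exp.2 ?_
          have h3 : n ≤ (n - 1 - d) + (d + 1) := by omega
          have h4 : (n : ℝ) ≤ ((n - 1 - d : ℕ) : ℝ) + (d + 1) := by exact_mod_cast h3
          nlinarith
  calc ((n - 1).choose d : ℝ) * x ^ d * (1 - x) ^ (n - 1 - d)
      ≤ (n : ℝ) ^ d / d.factorial * x ^ d * (Real.exp (-(n * x)) * Real.exp (x * (d + 1))) := by
        gcongr
    _ = _ := by
        unfold poissonTerm
        rw [mul_pow]
        ring

/-- Relative error in the Poisson lower bound for binomial weights. -/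
noncomputable def poissonError (n m : ℕ) (l : ℝ) : ℝ :=
  (1 - m / n) ^ m * Real.exp (-(2 * (l ^ 2 / n)))

theorem poissonTerm_le_binomial (n m : ℕ) (x : ℝ) (hn : m < n) (hx0 : 0 ≤ x) (hx1 : x ≤ 1 / 2) :
    poissonTerm m (n * x) * poissonError n m (n * x)
      ≤ (n - 1).choose m * x ^ m * (1 - x) ^ (n - 1 - m) := by
  have hn0 : (0 : ℝ) < n := by exact_mod_cast (show 0 < n by omega)
  have h1 : ((n : ℝ) - m) ^ m / m.factorial ≤ ((n - 1).choose m : ℝ) := by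
    refine le_trans ?_ (Nat.pow_le_choose m (n - 1))
    have h2 : (n : ℝ) - m = ((n - 1 + 1 - m : ℕ) : ℝ) := by
      rw [show n - 1 + 1 - m = n - m by omega, Nat.cast_sub hn.le]
    rw [h2]
  have h3 : Real.exp (-(n * x)) * Real.exp (-(2 * ((n * x) ^ 2 / n))) ≤ (1 - x) ^ (n - 1 - m) := by
    have hb : Real.exp (-(x + 2 * x ^ 2)) ≤ 1 - x := by
      have h4 := Real.add_one_le_exp (x + 2 * x ^ 2)
      rw [Real.exp_neg]
      refine inv_le_of_inv_le₀ (by linarith) ?_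
      refine le_trans ?_ h4
      rw [inv_le_iff_one_le_mul₀ (by linarith)]
      nlinarith [mul_nonneg (sq_nonneg x) (show 0 ≤ 1 - 2 * x by linarith)]
    calc _ = Real.exp (n * -(x + 2 * x ^ 2)) := by
          rw [← Real.exp_add]
          congr 1
          field_simp
          ring
      _ = Real.exp (-(x + 2 * x ^ 2)) ^ n := Real.exp_nat_mul _ _
      _ ≤ (1 - x) ^ n := by gcongr
      _ ≤ (1 - x) ^ (n - 1 - m) :=
          pow_le_pow_of_le_one (by linarith) (by linarith) (by omega)
  have hnm : (0 : ℝ) ≤ (n : ℝ) - m := by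
    have : (m : ℝ) ≤ n := by exact_mod_cast hn.le
    linarith
  calc poissonTerm m (n * x) * poissonError n m (n * x)
      = ((n : ℝ) - m) ^ m / m.factorial * x ^ m *
          (Real.exp (-(n * x)) * Real.exp (-(2 * ((n * x) ^ 2 / n)))) := by
        unfold poissonTerm poissonError
        have : (n : ℝ) - m = n * (1 - m / n) := by field_simp
        rw [this, mul_pow (n : ℝ) x, mul_pow (n : ℝ) (1 - (m : ℝ) / n)]
        ring
    _ ≤ _ := by gcongr

theorem one_sub_prob_le_poisson (q n K P m : ℕ) (p : ℝ) (hKP : K ≤ P) (hqK : q ≤ K)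
    (hp0 : 0 ≤ p) (hp1 : p ≤ 1) (hn : m < n) (hpe0 : 0 < peq q K P p)
    (hpe : peq q K P p ≤ 1 / 2) (hm : (m : ℝ) ≤ n * peq q K P p) (l : ℝ)
    (hl : l = n * peq q K P p) :
    1 - prob n K P p {ω | minDeg q n P ω = m}
      ≤ Real.exp (l / n * (m + 1)) * (∑ d ∈ Finset.range m, n * poissonTerm d l)
        + (1 / (n * poissonTerm m l * poissonError n m l)
          + ((1 + (m / l) ^ 2) * Real.exp (4 * (l / n) * (m + 1)) * expMoment q n K P p
              / poissonError n m l ^ 2 - 1)) := by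
  have hn0 : (0 : ℝ) < n := by exact_mod_cast (show 0 < n by omega)
  have hln : l / n = peq q K P p := by rw [hl]; field_simp
  have hl0 : 0 < l := by rw [hl]; positivity
  have hΦ : 0 ≤ expMoment q n K P p :=
    Finset.sum_nonneg fun s _ => mul_nonneg (ringWeight_nonneg _ _ _) <|
      Finset.sum_nonneg fun s' _ => mul_nonneg (ringWeight_nonneg _ _ _) (Real.exp_pos _).le
  rw [hln]
  set x := peq q K P p
  have hQ : 0 < poissonTerm m l := by unfold poissonTerm; positivity
  have hρ : 0 < poissonError n m l := by
    unfold poissonError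
    have : (0 : ℝ) < 1 - m / n := by
      rw [sub_pos, div_lt_one hn0]
      exact_mod_cast hn
    positivity
  have hP₁ := poissonTerm_le_binomial n m x hn hpe0.le hpe
  rw [← hl] at hP₁
  set P₁ := ((n - 1).choose m : ℝ) * x ^ m * (1 - x) ^ (n - 1 - m) with hP₁def
  have hP₁0 : 0 < P₁ := lt_of_lt_of_le (by positivity) hP₁
  have hmain := one_sub_prob_le q n K P m p P₁
    (poissonTerm m l ^ 2 * (1 + (m / l) ^ 2) * Real.exp (4 * x * (m + 1)) * expMoment q n K P p)
    hKP hp0 hp1 (by omega) hP₁0 (by positivity)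
    (fun i => mean_degree_eq q n K P p hKP hqK i m)
    (fun i i' hii' => by
      rw [hl]
      exact mean_degInd_mul_degInd_le q n K P m p hKP hqK hp0 hp1 i i' hii' hpe0 hpe hm (by omega))
  refine hmain.trans ?_
  have hA : (∑ d ∈ Finset.range m, ∑ i : Fin n, mean n K P p (degInd q d i))
      ≤ Real.exp (x * (m + 1)) * (∑ d ∈ Finset.range m, n * poissonTerm d l) := by
    rw [Finset.mul_sum]
    refine Finset.sum_le_sum fun d hd => ?_
    have hdm : (d : ℝ) ≤ m := by exact_mod_cast (Finset.mem_range.1 hd).le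
    have h1 : ∀ i : Fin n, mean n K P p (degInd q d i)
        ≤ poissonTerm d l * Real.exp (x * (m + 1)) := by
      intro i
      have h2 : mean n K P p (degInd q d i) = _ := mean_degree_eq q n K P p hKP hqK i d
      rw [h2]
      refine (binomial_le_poissonTerm n d x (by omega) hpe0.le (by linarith)).trans ?_
      rw [← hl]
      have := poissonTerm_nonneg d hl0.le
      gcongr
    refine (Finset.sum_le_sum fun i _ => h1 i).trans (le_of_eq ?_)
    simp
    ring
  have hB : 1 / (n * P₁) ≤ 1 / (n * poissonTerm m l * poissonError n m l) := by
    rw [mul_assoc]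
    gcongr
  have hC : poissonTerm m l ^ 2 * (1 + (m / l) ^ 2) * Real.exp (4 * x * (m + 1)) *
        expMoment q n K P p / P₁ ^ 2
      ≤ (1 + (m / l) ^ 2) * Real.exp (4 * x * (m + 1)) * expMoment q n K P p
              / poissonError n m l ^ 2 := by
    calc _ ≤ poissonTerm m l ^ 2 * (1 + (m / l) ^ 2) * Real.exp (4 * x * (m + 1)) *
          expMoment q n K P p / (poissonTerm m l * poissonError n m l) ^ 2 := by gcongr
      _ = _ := by
          field_simp
  linarith

theorem prob_le_one (n K P : ℕ) (p : ℝ) (hKP : K ≤ P) (hp0 : 0 ≤ p) (hp1 : p ≤ 1)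
    (E : Set (Config n P)) : prob n K P p E ≤ 1 := by
  rw [← sum_weight n K P p hKP]
  exact Finset.sum_le_sum fun ω _ =>
    Set.indicator_le_self' (fun _ _ => weight_nonneg n K P p hp0 hp1 ω) ω

/-! ### Asymptotics -/

theorem tendsto_log_natCast : Tendsto (fun n : ℕ => Real.log (n : ℝ)) atTop atTop :=
  Real.tendsto_log_atTop.comp tendsto_natCast_atTop_atTop

theorem eventually_log_log_le (ε : ℝ) (hε : 0 < ε) :
    ∀ᶠ n : ℕ in atTop, Real.log (Real.log (n : ℝ)) ≤ ε * Real.log n := by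
  have h := (Real.isLittleO_log_id_atTop.comp_tendsto tendsto_log_natCast).bound hε
  filter_upwards [h, tendsto_log_natCast.eventually_ge_atTop 0] with n hn h0
  simp only [Function.comp, id, Real.norm_eq_abs, abs_of_nonneg h0] at hn
  exact (le_abs_self _).trans hn

theorem tendsto_log_sq_div : Tendsto (fun n : ℕ => Real.log (n : ℝ) ^ 2 / n) atTop (nhds 0) := by
  have h := (Real.tendsto_pow_mul_exp_neg_atTop_nhds_zero 2).comp tendsto_log_natCast
  refine h.congr' ?_
  filter_upwards [eventually_gt_atTop 0] with n hn
  have hn0 : (0 : ℝ) < n := by exact_mod_cast hn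
  simp only [Function.comp]
  rw [Real.exp_neg, Real.exp_log hn0, div_eq_mul_inv]

theorem eventually_expMoment_le (q : ℕ) (hq : 1 ≤ q) (K P : ℕ → ℕ) (p l : ℕ → ℝ)
    (hKP : ∀ n, K n ≤ P n) (hp : ∀ n, p n ∈ Set.Ioc (0 : ℝ) 1)
    (hKinf : Tendsto (fun n => (K n : ℝ)) atTop atTop)
    (hKsqP : Tendsto (fun n => ((K n : ℝ)) ^ 2 / (P n : ℝ)) atTop (nhds 0))
    (hl : ∀ᶠ n : ℕ in atTop, l n = n * peq q (K n) (P n) (p n))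
    (hl0 : ∀ᶠ n : ℕ in atTop, 0 ≤ l n)
    (hl2 : ∀ᶠ n : ℕ in atTop, l n ≤ 2 * Real.log n) :
    ∃ U : ℕ → ℝ, Tendsto U atTop (nhds 1) ∧
      ∀ᶠ n in atTop, expMoment q n (K n) (P n) (p n) ≤ U n := by
  have hc := psqConst_pos q
  set c := psqConst q with hcdef
  set y : ℕ → ℝ := fun n => Real.log (n : ℝ) with hy
  set x : ℕ → ℝ := fun n => ((K n : ℝ)) ^ 2 / (P n : ℝ) with hx
  refine ⟨fun n => 1 + 32 * ((y n / 2) ^ 2 * Real.exp (-(y n / 2)))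
    + (Real.exp 2 * x n ^ (5 * q) + (4 / c) ^ 5 * (y n ^ 10 * Real.exp (-(y n)))), ?_, ?_⟩
  · have hy2 : Tendsto (fun n => y n / 2) atTop atTop :=
      tendsto_log_natCast.atTop_div_const (by norm_num)
    have h1 := (Real.tendsto_pow_mul_exp_neg_atTop_nhds_zero 2).comp hy2
    have h2 := (Real.tendsto_pow_mul_exp_neg_atTop_nhds_zero 10).comp tendsto_log_natCast
    have h3 : Tendsto (fun n => x n ^ (5 * q)) atTop (nhds 0) := by
      have := hKsqP.pow (5 * q)
      rwa [zero_pow (by omega)] at this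
    have := ((tendsto_const_nhds (x := (1 : ℝ))).add (h1.const_mul 32)).add
      ((h3.const_mul (Real.exp 2)).add (h2.const_mul ((4 / c) ^ 5)))
    simpa [Function.comp_def] using this
  · have hKbig : ∀ᶠ n in atTop, ((5 * q : ℕ) : ℝ) ≤ K n := hKinf.eventually_ge_atTop _
    have hx4 : ∀ᶠ n in atTop, x n ≤ 1 / 4 := hKsqP.eventually_le_const (by norm_num)
    have hη : ∀ᶠ n in atTop,
        (2 ^ (q + 1) * x n + ((5 * q : ℕ) : ℝ) / K n) / c ≤ 1 / 8 := by
      have h1 : Tendsto (fun n => (2 ^ (q + 1) * x n + ((5 * q : ℕ) : ℝ) / K n) / c) atTop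
          (nhds 0) := by
        have := ((hKsqP.const_mul (2 ^ (q + 1))).add
          (hKinf.const_div_atTop ((5 * q : ℕ) : ℝ))).div_const c
        simpa using this
      exact h1.eventually_le_const (by norm_num)
    filter_upwards [hKbig, hx4, hη, hl, hl0, hl2, eventually_gt_atTop 0] with
      n hK hx4 hη hl hl0 hl2 hn
    have hn0 : (0 : ℝ) < n := by exact_mod_cast hn
    have hK' : 5 * q ≤ K n := by exact_mod_cast hK
    obtain ⟨hp0, hp1⟩ := hp n
    have hey : Real.exp (-(y n)) = 1 / n := by
      rw [Real.exp_neg, hy, Real.exp_log hn0, one_div]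
    have hmain := expMoment_le q n (K n) (P n) (5 * q) (p n) hq (hKP n) (by omega) hK' hp0.le hp1
      hx4 hn
    rw [← hl, ← hcdef] at hmain
    have hx0 : 0 ≤ x n := by positivity
    refine hmain.trans (add_le_add (add_le_add le_rfl ?_) ?_)
    · have h1 : Real.exp (2 * l n * ((2 ^ (q + 1) * x n + ((5 * q : ℕ) : ℝ) / K n) / c))
          ≤ Real.exp (y n / 2) := by
        refine Real.exp_le_exp.2 ?_
        calc _ ≤ 2 * l n * (1 / 8) := by gcongr
          _ ≤ 2 * (2 * y n) * (1 / 8) := by gcongr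
          _ = y n / 2 := by ring
      calc _ ≤ 2 * ((2 * y n) ^ 2 / n) * Real.exp (y n / 2) := by gcongr
        _ = 8 * y n ^ 2 * (1 / n) * Real.exp (y n / 2) := by ring
        _ = 8 * y n ^ 2 * (Real.exp (-(y n)) * Real.exp (y n / 2)) := by rw [← hey]; ring
        _ = 32 * ((y n / 2) ^ 2 * Real.exp (-(y n / 2))) := by
            rw [← Real.exp_add, show -(y n) + y n / 2 = -(y n / 2) by ring]
            ring
    · by_cases hpl : l n * p n ≤ 1
      · have h1 : Real.exp (2 * l n * p n) * x n ^ (5 * q) ≤ Real.exp 2 * x n ^ (5 * q) := by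
          gcongr
          linarith
        have h2 : 0 ≤ (4 / c) ^ 5 * (y n ^ 10 * Real.exp (-(y n))) := by
          have : Even 10 := ⟨5, rfl⟩
          have := this.pow_nonneg (y n)
          positivity
        exact h1.trans (by linarith)
      · push Not at hpl
        have hps : c * x n ^ q ≤ (2 * y n) ^ 2 / n := by
          refine (le_psq q (K n) (P n) (hKP n) (by omega) (by omega) hx4).trans ?_
          calc psq q (K n) (P n) ≤ (l n * p n) * psq q (K n) (P n) :=
                le_mul_of_one_le_left (psq_nonneg q _ _ (hKP n) (by omega)) hpl.le
            _ = l n ^ 2 / n := by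
                rw [eq_div_iff hn0.ne', sq]
                conv_rhs => rw [hl]
                conv_lhs => rw [hl]
                rw [peq]
                ring
            _ ≤ _ := by gcongr
        have hxq : x n ^ q ≤ (4 / c) * (y n ^ 2 * Real.exp (-(y n))) := by
          rw [hey, div_mul_eq_mul_div, le_div_iff₀ hc, mul_comm]
          refine hps.trans (le_of_eq (by ring))
        have h1 : Real.exp (2 * l n * p n) ≤ Real.exp (4 * y n) := by
          refine Real.exp_le_exp.2 ?_
          calc 2 * l n * p n ≤ 2 * l n * 1 := by gcongr
            _ ≤ _ := by linarith
        calc Real.exp (2 * l n * p n) * x n ^ (5 * q)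
            = Real.exp (2 * l n * p n) * (x n ^ q) ^ 5 := by rw [← pow_mul, mul_comm q 5]
          _ ≤ Real.exp (4 * y n) * ((4 / c) * (y n ^ 2 * Real.exp (-(y n)))) ^ 5 := by gcongr
          _ = (4 / c) ^ 5 * (y n ^ 10 * (Real.exp (4 * y n) * Real.exp (-(y n)) ^ 5)) := by ring
          _ = (4 / c) ^ 5 * (y n ^ 10 * Real.exp (-(y n))) := by
              rw [← Real.exp_nat_mul, ← Real.exp_add]
              congr 3
              push_cast
              ring
          _ ≤ _ := le_add_of_nonneg_left (by positivity)

theorem tendsto_prob_minDeg (q : ℕ) (hq : 1 ≤ q) (m : ℕ) (K P : ℕ → ℕ) (p β : ℕ → ℝ)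
    (c₁ c₂ : ℝ) (hc₁ : -1 < c₁) (hc₂ : c₂ < 1)
    (hKP : ∀ n, K n ≤ P n) (hp : ∀ n, p n ∈ Set.Ioc (0 : ℝ) 1)
    (hKinf : Tendsto (fun n => (K n : ℝ)) atTop atTop)
    (hKsqP : Tendsto (fun n => ((K n : ℝ)) ^ 2 / (P n : ℝ)) atTop (nhds 0))
    (hpe : ∀ n : ℕ, peq q (K n) (P n) (p n)
      = (Real.log (n : ℝ) + m * Real.log (Real.log (n : ℝ)) + β n) / (n : ℝ))
    (hβbound : ∀ᶠ (n : ℕ) in atTop,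
      c₁ * Real.log (Real.log (n : ℝ)) ≤ β n ∧ β n ≤ c₂ * Real.log (Real.log (n : ℝ)))
    (hβ : Tendsto β atTop atBot) :
    Tendsto (fun n => prob n (K n) (P n) (p n) {ω | minDeg q n (P n) ω = m}) atTop (nhds 1) := by
  set y : ℕ → ℝ := fun n => Real.log (n : ℝ) with hy
  set z : ℕ → ℝ := fun n => Real.log (y n) with hz
  have hytop : Tendsto y atTop atTop := tendsto_log_natCast
  have hztop : Tendsto z atTop atTop := Real.tendsto_log_atTop.comp hytop
  set l : ℕ → ℝ := fun n => y n + m * z n + β n with hldef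
  have hl : ∀ᶠ n : ℕ in atTop, l n = n * peq q (K n) (P n) (p n) := by
    filter_upwards [eventually_gt_atTop 0] with n hn
    have hn0 : (n : ℝ) ≠ 0 := by exact_mod_cast hn.ne'
    rw [hpe, mul_div_cancel₀ _ hn0]
  have hlge : ∀ᶠ n : ℕ in atTop, y n / 2 ≤ l n := by
    filter_upwards [hβbound, eventually_log_log_le (1 / 2) (by norm_num),
      hztop.eventually_ge_atTop 0] with n h1 h2 h3
    have h4 : (0 : ℝ) ≤ m * z n := by positivity
    have h5 : -z n ≤ c₁ * z n := by nlinarith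
    have h6 := h1.1
    simp only [hldef]
    change z n ≤ 1 / 2 * y n at h2
    change c₁ * z n ≤ β n at h6
    linarith
  have hlle : ∀ᶠ n : ℕ in atTop, l n ≤ 2 * y n := by
    filter_upwards [hβbound, eventually_log_log_le (1 / (m + 1)) (by positivity),
      hztop.eventually_ge_atTop 0] with n h1 h2 h3
    have h5 : c₂ * z n ≤ z n := by nlinarith
    have h6 := h1.2
    change z n ≤ 1 / (m + 1) * y n at h2
    change β n ≤ c₂ * z n at h6
    have h7 : (m + 1 : ℝ) * z n ≤ y n := by
      rw [div_mul_eq_mul_div, le_div_iff₀ (by positivity)] at h2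
      linarith
    simp only [hldef]
    linarith
  have hl0 : ∀ᶠ n : ℕ in atTop, 0 ≤ l n := by
    filter_upwards [hlge, hytop.eventually_ge_atTop 0] with n h1 h2
    linarith
  have hltop : Tendsto l atTop atTop :=
    tendsto_atTop_mono' _ hlge (hytop.atTop_div_const (by norm_num))
  have hlsq : Tendsto (fun n : ℕ => l n ^ 2 / n) atTop (nhds 0) := by
    have h4 : Tendsto (fun n : ℕ => 4 * (y n ^ 2 / n)) atTop (nhds 0) := by
      simpa using tendsto_log_sq_div.const_mul 4
    refine squeeze_zero' (Eventually.of_forall fun n => by positivity) ?_ h4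
    filter_upwards [hl0, hlle] with n h1 h2
    calc l n ^ 2 / n ≤ (2 * y n) ^ 2 / n := by gcongr
      _ = _ := by ring
  have hln : Tendsto (fun n : ℕ => l n / n) atTop (nhds 0) := by
    refine squeeze_zero' ?_ ?_ hlsq
    · filter_upwards [hl0] with n h1
      positivity
    · filter_upwards [hltop.eventually_ge_atTop 1] with n h1
      gcongr
      nlinarith
  obtain ⟨U, hU, hUle⟩ := eventually_expMoment_le q hq K P p l hKP hp hKinf hKsqP hl hl0 hlle
  have hnexp : ∀ᶠ n : ℕ in atTop, (n : ℝ) * Real.exp (-l n) = Real.exp (-(m * z n) - β n) := by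
    filter_upwards [eventually_gt_atTop 0] with n hn
    have hn0 : (0 : ℝ) < n := by exact_mod_cast hn
    nth_rewrite 1 [← Real.exp_log hn0]
    rw [← Real.exp_add]
    congr 1
    simp only [hldef, hy]
    ring
  have hypow : ∀ᶠ n : ℕ in atTop, ∀ d : ℕ, y n ^ d = Real.exp (d * z n) := by
    filter_upwards [hytop.eventually_gt_atTop 0] with n hn d
    rw [Real.exp_nat_mul, hz, Real.exp_log hn]
  have hsmall : ∀ d ∈ Finset.range m,
      Tendsto (fun n : ℕ => n * poissonTerm d (l n)) atTop (nhds 0) := by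
    intro d hd
    have hdm : (d : ℝ) + 1 ≤ m := by exact_mod_cast Finset.mem_range.1 hd
    have h0 : Tendsto (fun n => 2 ^ d / (d.factorial : ℝ) * Real.exp (-((1 + c₁) * z n))) atTop
        (nhds 0) := by
      have h1 : Tendsto (fun n => Real.exp (-((1 + c₁) * z n))) atTop (nhds 0) :=
        Real.tendsto_exp_neg_atTop_nhds_zero.comp (hztop.const_mul_atTop (by linarith))
      simpa using h1.const_mul (2 ^ d / (d.factorial : ℝ))
    refine squeeze_zero' ?_ ?_ h0
    · filter_upwards [hl0] with n h1
      exact mul_nonneg (Nat.cast_nonneg _) (poissonTerm_nonneg d h1)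
    · filter_upwards [hl0, hlle, hnexp, hypow, hβbound, hztop.eventually_ge_atTop 0] with
        n h1 h2 h3 h4 h5 h6
      have h7 : c₁ * z n ≤ β n := h5.1
      calc n * poissonTerm d (l n) = l n ^ d / d.factorial * (n * Real.exp (-l n)) := by
            unfold poissonTerm
            ring
        _ ≤ (2 * y n) ^ d / d.factorial * (n * Real.exp (-l n)) := by gcongr
        _ = 2 ^ d / d.factorial * (Real.exp (d * z n) * Real.exp (-(m * z n) - β n)) := by
            rw [h3, mul_pow, h4]
            ring
        _ ≤ _ := by
            rw [← Real.exp_add]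
            gcongr
            nlinarith
  have hbig : Tendsto (fun n : ℕ => n * poissonTerm m (l n)) atTop atTop := by
    have h0 : Tendsto (fun n => (2 ^ m * (m.factorial : ℝ))⁻¹ * Real.exp (-β n)) atTop atTop :=
      (Real.tendsto_exp_atTop.comp (tendsto_neg_atBot_atTop.comp hβ)).const_mul_atTop
        (by positivity)
    refine tendsto_atTop_mono' _ ?_ h0
    filter_upwards [hlge, hnexp, hypow, hytop.eventually_ge_atTop 0] with n h1 h3 h4 h5
    calc (2 ^ m * (m.factorial : ℝ))⁻¹ * Real.exp (-β n)
        = (2 ^ m * (m.factorial : ℝ))⁻¹ * (Real.exp (m * z n) * Real.exp (-(m * z n) - β n)) := by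
          rw [← Real.exp_add]
          congr 2
          ring
      _ = (y n / 2) ^ m / m.factorial * (n * Real.exp (-l n)) := by
          rw [h3, div_pow, h4, mul_inv]
          ring
      _ ≤ l n ^ m / m.factorial * (n * Real.exp (-l n)) := by gcongr
      _ = _ := by
          unfold poissonTerm
          ring
  have hρ : Tendsto (fun n : ℕ => poissonError n m (l n)) atTop (nhds 1) := by
    have h1 : Tendsto (fun n : ℕ => (1 - (m : ℝ) / n) ^ m) atTop (nhds 1) := by
      have := ((tendsto_const_nhds (x := (1 : ℝ))).sub
        (tendsto_const_div_atTop_nhds_zero_nat (m : ℝ))).pow m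
      simpa using this
    have h2 : Tendsto (fun n : ℕ => Real.exp (-(2 * (l n ^ 2 / n)))) atTop (nhds 1) := by
      have := (Real.continuous_exp.tendsto _).comp (hlsq.const_mul 2).neg
      simpa [Function.comp_def] using this
    simpa [poissonError] using h1.mul h2
  have hexp : ∀ c : ℝ,
      Tendsto (fun n : ℕ => Real.exp (c * (l n / n) * (m + 1))) atTop (nhds 1) := by
    intro c
    have := (Real.continuous_exp.tendsto _).comp ((hln.const_mul c).mul_const ((m : ℝ) + 1))
    simpa [Function.comp_def] using this
  have hbound : Tendsto (fun n : ℕ =>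
      Real.exp (l n / n * (m + 1)) * (∑ d ∈ Finset.range m, n * poissonTerm d (l n))
        + (1 / (n * poissonTerm m (l n) * poissonError n m (l n))
          + ((1 + (m / l n) ^ 2) * Real.exp (4 * (l n / n) * (m + 1)) * U n
              / poissonError n m (l n) ^ 2 - 1))) atTop (nhds 0) := by
    have h1 : Tendsto (fun n : ℕ => Real.exp (l n / n * (m + 1))) atTop (nhds 1) := by
      simpa using hexp 1
    have h2 := tendsto_finsetSum (Finset.range m) hsmall
    have h3 : Tendsto (fun n : ℕ => 1 / (n * poissonTerm m (l n) * poissonError n m (l n))) atTop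
        (nhds 0) := (hbig.atTop_mul_pos one_pos hρ).const_div_atTop 1
    have h4 : Tendsto (fun n : ℕ => 1 + ((m : ℝ) / l n) ^ 2) atTop (nhds 1) := by
      simpa using (tendsto_const_nhds (x := (1 : ℝ))).add ((hltop.const_div_atTop (m : ℝ)).pow 2)
    have h5 := (((h4.mul (hexp 4)).mul hU).div (hρ.pow 2) (by norm_num)).sub_const 1
    have h6 := (h1.mul h2).add (h3.add h5)
    simpa using h6
  have hlow := hbound.const_sub 1
  rw [sub_zero] at hlow
  refine tendsto_of_tendsto_of_tendsto_of_le_of_le' hlow tendsto_const_nhds ?_ ?_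
  · filter_upwards [hl, hUle, hltop.eventually_ge_atTop m, hltop.eventually_gt_atTop 0,
      hln.eventually_le_const (show (0 : ℝ) < 1 / 2 by norm_num), eventually_gt_atTop m,
      hKinf.eventually_ge_atTop (q : ℝ)] with n h1 h2 h3 h4 h5 h6 h7
    have hn0 : (0 : ℝ) < n := by exact_mod_cast (show 0 < n by omega)
    have hpe' : peq q (K n) (P n) (p n) = l n / n := by rw [h1]; field_simp
    have hmain := one_sub_prob_le_poisson q n (K n) (P n) m (p n) (hKP n) (by exact_mod_cast h7)
      (hp n).1.le (hp n).2 h6 (by rw [hpe']; positivity) (by rw [hpe']; exact h5)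
      (by rw [← h1]; exact h3) (l n) h1
    have h8 : (1 + (m / l n) ^ 2) * Real.exp (4 * (l n / n) * (m + 1)) *
          expMoment q n (K n) (P n) (p n) / poissonError n m (l n) ^ 2
        ≤ (1 + (m / l n) ^ 2) * Real.exp (4 * (l n / n) * (m + 1)) * U n
          / poissonError n m (l n) ^ 2 := by gcongr
    linarith
  · exact Eventually.of_forall fun n => prob_le_one n _ _ _ (hKP n) (hp n).1.le (hp n).2 _

/-- under the fine-grained scaling
`p_{e,q}(n) = (ln n + (k−1) ln ln n + b ln ln n + β_n)/n` with `k + b ≥ 1` and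
`−1 < liminf β_n/ln ln n ≤ limsup β_n/ln ln n < 1` (i.e.,
`c₁ ln ln n ≤ β_n ≤ c₂ ln ln n` eventually, for constants `−1 < c₁ ≤ c₂ < 1`),
if `β_n → −∞` then `P[min degree = k+b−1] → 1`. -/
theorem min_degree_eq_kb_sub_one_prob_one
    (q : ℕ) (hq : 1 ≤ q) (k : ℕ) (hk : 1 ≤ k) (b : ℤ)
    (K P : ℕ → ℕ) (p : ℕ → ℝ) (β : ℕ → ℝ)
    (c₁ c₂ : ℝ) (hc₁ : -1 < c₁) (hc₁₂ : c₁ ≤ c₂) (hc₂ : c₂ < 1)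
    (hK1 : ∀ n, 1 ≤ K n) (hKP : ∀ n, K n ≤ P n)
    (hp : ∀ n, p n ∈ Set.Ioc (0 : ℝ) 1)
    (hKinf : Tendsto (fun n => (K n : ℝ)) atTop atTop)
    (hKsqP : Tendsto (fun n => ((K n : ℝ)) ^ 2 / (P n : ℝ)) atTop (nhds 0))
    (hpe : ∀ n : ℕ, peq q (K n) (P n) (p n)
      = (Real.log (n : ℝ) + ((k : ℝ) - 1) * Real.log (Real.log (n : ℝ))
          + (b : ℝ) * Real.log (Real.log (n : ℝ)) + β n) / (n : ℝ))
    (hβbound : ∀ᶠ (n : ℕ) in atTop,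
      c₁ * Real.log (Real.log (n : ℝ)) ≤ β n ∧ β n ≤ c₂ * Real.log (Real.log (n : ℝ)))
    (hkb : 1 ≤ (k : ℤ) + b) (hβ : Tendsto β atTop atBot) :
    Tendsto (fun n => prob n (K n) (P n) (p n)
        {ω | (minDeg q n (P n) ω : ℤ) = (k : ℤ) + b - 1})
      atTop (nhds 1) := by
  obtain ⟨m, hm⟩ := Int.eq_ofNat_of_zero_le (show 0 ≤ (k : ℤ) + b - 1 by omega)
  have hm' : (m : ℝ) = (k : ℝ) + b - 1 := by exact_mod_cast hm.symm
  have hpe' : ∀ n : ℕ, peq q (K n) (P n) (p n)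
      = (Real.log (n : ℝ) + m * Real.log (Real.log (n : ℝ)) + β n) / (n : ℝ) := fun n => by
    rw [hpe, hm']
    ring
  simp only [hm, Nat.cast_inj]
  exact tendsto_prob_minDeg q hq m K P p β c₁ c₂ hc₁ hc₂ hKP hp hKinf hKsqP hpe' hβbound hβ
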